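/- arXiv:1806.10188 — 10 statements merged into one kernel-verified Lean document; each statement's English description precedes it below -/
import Mathlib

section
/- Let F(w) = (1/2)wᵀAw + bᵀw + c be a quadratic function on ℝ^d where A is a symmetric positive semidefinite matrix all of whose eigenvalues lie in [λ, μ] with 0 < λ ≤ μ, and let w* be a minimizer of F. Let τ ≥ 0 be an integer, let η ∈ (0, 1/(20μ(τ+1))], and let the iterates of delayed gradient descent be defined by w_0 = w_1 = … = w_τ and w_{k+1} = w_k − η∇F(w_{k−τ}) for k ≥ τ. Then for every k ≥ (τ+1)·ln(2(τ+1)), F(w_k) − F(w*) ≤ 5μ(1 − ηλ)^{2(k+1)}·‖w_0 − w*‖². -/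
open Matrix

/-- Euclidean norm on `Fin d → ℝ`. -/
noncomputable def eNorm {d : ℕ} (v : Fin d → ℝ) : ℝ := Real.sqrt (∑ i, (v i) ^ 2)

/-- The scalar delayed recursion decays geometrically when its initial value is nonnegative. -/
lemma delayed_scalar_bound_of_nonneg (τ : ℕ) (x : ℝ) (hx : 0 ≤ x) (hx2 : 20 * x * (τ + 1) ≤ 1)
    (u : ℕ → ℝ) (hinit : ∀ j, j ≤ τ → u j = u 0)
    (hrec : ∀ j, τ ≤ j → u (j + 1) = u j - x * u (j - τ)) (h0 : 0 ≤ u 0) (k : ℕ) :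
    0 ≤ u k ∧ u k ≤ 2 * (1 - x) ^ (k + 1) * u 0 := by
  have hτ : (0 : ℝ) ≤ τ := τ.cast_nonneg
  have hxτ : 0 ≤ x * τ := mul_nonneg hx hτ
  have bern : 9 / 10 ≤ (1 - 2 * x) ^ τ := by
    have h := one_add_mul_le_pow (show (-2 : ℝ) ≤ -(2 * x) by nlinarith) τ
    rw [← sub_eq_add_neg] at h
    nlinarith
  have bern' : 1 / 2 ≤ (1 - x) ^ (τ + 1) := by
    have h := one_add_mul_le_pow (show (-2 : ℝ) ≤ -x by nlinarith) (τ + 1)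
    rw [← sub_eq_add_neg] at h
    push_cast at h
    nlinarith
  have inv : ∀ n, 0 ≤ u n ∧ (1 - 2 * x) * u n ≤ u (n + 1) ∧ u (n + 1) ≤ u n := by
    intro n
    induction n using Nat.strong_induction_on with
    | _ n ih =>
      have hn : 0 ≤ u n := by
        rcases n with _ | m
        · exact h0
        · obtain ⟨h1, h2, -⟩ := ih m m.lt_succ_self
          exact (mul_nonneg (by nlinarith) h1).trans h2
      refine ⟨hn, ?_⟩
      rcases lt_or_ge n τ with h | h
      · rw [hinit n h.le, hinit (n + 1) h]
        exact ⟨by nlinarith, le_rfl⟩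
      · have hpow : ∀ i, i ≤ τ → (1 - 2 * x) ^ i * u (n - τ) ≤ u (n - τ + i) := by
          intro i
          induction i with
          | zero => simp
          | succ i ihi =>
            intro hi
            have h1 := (ih (n - τ + i) (by omega)).2.1
            have h2 := ihi (by omega)
            calc (1 - 2 * x) ^ (i + 1) * u (n - τ)
                = (1 - 2 * x) * ((1 - 2 * x) ^ i * u (n - τ)) := by ring
              _ ≤ (1 - 2 * x) * u (n - τ + i) :=
                mul_le_mul_of_nonneg_left h2 (by nlinarith)
              _ ≤ u (n - τ + (i + 1)) := h1
        have hlow := hpow τ le_rfl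
        rw [Nat.sub_add_cancel h] at hlow
        have hm : 0 ≤ u (n - τ) := by
          rcases Nat.lt_or_ge (n - τ) n with h' | h'
          · exact (ih _ h').1
          · rwa [show n - τ = n by omega]
        have h9 : 9 / 10 * u (n - τ) ≤ u n := (mul_le_mul_of_nonneg_right bern hm).trans hlow
        rw [hrec n h]
        constructor
        · nlinarith [mul_le_mul_of_nonneg_left h9 hx, mul_nonneg hx hm]
        · nlinarith [mul_nonneg hx hm]
  have anti : Antitone u := antitone_nat_of_succ_le fun n => (inv n).2.2
  have hx1 : 0 ≤ 1 - x := by nlinarith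
  have hdecay : ∀ m, u (τ + m) ≤ (1 - x) ^ m * u 0 := by
    intro m
    induction m with
    | zero => simp [hinit τ le_rfl]
    | succ m ihm =>
      have h1 := hrec (τ + m) (by omega)
      have h2 := mul_le_mul_of_nonneg_left (anti (Nat.sub_le (τ + m) τ)) hx
      calc u (τ + (m + 1)) ≤ (1 - x) * u (τ + m) := by rw [← add_assoc]; linarith
        _ ≤ (1 - x) * ((1 - x) ^ m * u 0) := mul_le_mul_of_nonneg_left ihm hx1
        _ = (1 - x) ^ (m + 1) * u 0 := by ring
  refine ⟨(inv k).1, ?_⟩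
  rcases le_total k τ with h | h
  · rw [hinit k h]
    have hpow : (1 - x) ^ (τ + 1) ≤ (1 - x) ^ (k + 1) :=
      pow_le_pow_of_le_one hx1 (by linarith) (Nat.succ_le_succ h)
    linarith [mul_le_mul_of_nonneg_right (bern'.trans hpow) h0]
  · obtain ⟨m, rfl⟩ := Nat.exists_eq_add_of_le h
    have hm := hdecay m
    have h3 : 0 ≤ (1 - x) ^ m * u 0 := mul_nonneg (pow_nonneg hx1 m) h0
    rw [show τ + m + 1 = (τ + 1) + m by ring, pow_add]
    nlinarith

lemma delayed_scalar_abs_bound (τ : ℕ) (x : ℝ) (hx : 0 ≤ x) (hx2 : 20 * x * (τ + 1) ≤ 1)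
    (u : ℕ → ℝ) (hinit : ∀ j, j ≤ τ → u j = u 0)
    (hrec : ∀ j, τ ≤ j → u (j + 1) = u j - x * u (j - τ)) (k : ℕ) :
    |u k| ≤ 2 * (1 - x) ^ (k + 1) * |u 0| := by
  rcases le_total 0 (u 0) with h | h
  · obtain ⟨h1, h2⟩ := delayed_scalar_bound_of_nonneg τ x hx hx2 u hinit hrec h k
    rwa [abs_of_nonneg h, abs_of_nonneg h1]
  · obtain ⟨h1, h2⟩ := delayed_scalar_bound_of_nonneg τ x hx hx2 (fun j => -u j)
      (fun j hj => by rw [hinit j hj]) (fun j hj => by rw [hrec j hj]; ring)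
      (by linarith) k
    rwa [abs_of_nonpos h, abs_of_nonpos (by linarith)]

section Eigencoordinates

variable {d : ℕ} {A : Matrix (Fin d) (Fin d) ℝ}

lemma dotProduct_mulVec_comm_of_isHermitian (hA : A.IsHermitian) (u v : Fin d → ℝ) :
    u ⬝ᵥ A.mulVec v = A.mulVec u ⬝ᵥ v := by
  have hAt : Aᵀ = A := by simpa using hA.eq
  rw [dotProduct_mulVec, ← mulVec_transpose, hAt]

lemma eigenvectorBasis_dotProduct_mulVec (hA : A.IsHermitian) (i : Fin d) (v : Fin d → ℝ) :
    (hA.eigenvectorBasis i).ofLp ⬝ᵥ A.mulVec v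
      = hA.eigenvalues i * ((hA.eigenvectorBasis i).ofLp ⬝ᵥ v) := by
  rw [dotProduct_mulVec_comm_of_isHermitian hA, hA.mulVec_eigenvectorBasis]
  simp

lemma dotProduct_eq_sum_eigenvectorBasis (hA : A.IsHermitian) (u v : Fin d → ℝ) :
    u ⬝ᵥ v = ∑ i, ((hA.eigenvectorBasis i).ofLp ⬝ᵥ u) * ((hA.eigenvectorBasis i).ofLp ⬝ᵥ v) := by
  have h := hA.eigenvectorBasis.sum_inner_mul_inner (WithLp.toLp 2 u) (WithLp.toLp 2 v)
  simp only [EuclideanSpace.inner_eq_star_dotProduct, star_trivial] at h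
  rw [dotProduct_comm u v, ← h]
  exact Finset.sum_congr rfl fun i _ => by rw [dotProduct_comm v]

/-- The gradient of a positive semidefinite quadratic function vanishes at a minimizer. -/
lemma mulVec_add_eq_zero_of_minimizer (hA : A.IsHermitian) (hPSD : A.PosSemidef)
    (b wstar : Fin d → ℝ)
    (hmin : ∀ v, (1 / 2) * (wstar ⬝ᵥ A.mulVec wstar) + b ⬝ᵥ wstar
      ≤ (1 / 2) * (v ⬝ᵥ A.mulVec v) + b ⬝ᵥ v) :
    A.mulVec wstar + b = 0 := by
  set g := A.mulVec wstar + b with hg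
  have hq : 0 ≤ g ⬝ᵥ A.mulVec g := by simpa using hPSD.dotProduct_mulVec_nonneg g
  have hgg : g ⬝ᵥ g = A.mulVec wstar ⬝ᵥ g + b ⬝ᵥ g := by
    nth_rewrite 1 [hg]
    rw [add_dotProduct]
  have key : ∀ s : ℝ, s * (g ⬝ᵥ g) ≤ s ^ 2 / 2 * (g ⬝ᵥ A.mulVec g) := by
    intro s
    have h := hmin (wstar - s • g)
    simp only [mulVec_sub, mulVec_smul, dotProduct_sub, sub_dotProduct, smul_dotProduct,
      dotProduct_smul, smul_eq_mul] at h
    rw [dotProduct_mulVec_comm_of_isHermitian hA wstar g,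
      dotProduct_comm g (A.mulVec wstar)] at h
    rw [hgg]
    linarith
  have hn : 0 ≤ g ⬝ᵥ g := by simpa using dotProduct_star_self_nonneg g
  set q := g ⬝ᵥ A.mulVec g
  have h := key ((g ⬝ᵥ g) / (q + 1))
  have hq1 : 0 < q + 1 := by linarith
  have hzero : g ⬝ᵥ g = 0 := by
    have h2 : (g ⬝ᵥ g) ^ 2 * (q + 1) ≤ (g ⬝ᵥ g) ^ 2 / 2 * q := by
      have := mul_le_mul_of_nonneg_right h (sq_nonneg (q + 1))
      field_simp at this
      nlinarith
    nlinarith [mul_nonneg (sq_nonneg (g ⬝ᵥ g)) hq, sq_nonneg (g ⬝ᵥ g)]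
  exact dotProduct_self_eq_zero.mp hzero

end Eigencoordinates

/-- **Theorem 1 (deterministic delayed gradient descent, strongly convex case).**
If all eigenvalues of the symmetric PSD matrix `A` lie in `[lam, mu]` with `0 < lam ≤ mu`,
`F w = (1/2) wᵀAw + bᵀw + c`, `wstar` minimizes `F`, `η ∈ (0, 1/(20 mu (τ+1))]`, and the
iterates satisfy `w_0 = … = w_τ` and `w_{k+1} = w_k - η ∇F(w_{k-τ})`, then for every
`k ≥ (τ+1) ln(2(τ+1))`, `F(w_k) - F(wstar) ≤ 5 mu (1 - η lam)^{2(k+1)} ‖w_0 - wstar‖²`. -/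
theorem dgd_strongly_convex {d : ℕ} (A : Matrix (Fin d) (Fin d) ℝ)
    (hA : A.IsHermitian) (hPSD : A.PosSemidef)
    (b : Fin d → ℝ) (c : ℝ) (lam mu : ℝ) (hlam : 0 < lam) (hlm : lam ≤ mu)
    (heig : ∀ i, lam ≤ hA.eigenvalues i ∧ hA.eigenvalues i ≤ mu)
    (F : (Fin d → ℝ) → ℝ)
    (hF : ∀ v, F v = (1 / 2) * (v ⬝ᵥ A.mulVec v) + b ⬝ᵥ v + c)
    (wstar : Fin d → ℝ) (hmin : ∀ v, F wstar ≤ F v)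
    (τ : ℕ) (η : ℝ) (hη : 0 < η) (hη2 : η ≤ 1 / (20 * mu * (τ + 1)))
    (w : ℕ → (Fin d → ℝ))
    (hinit : ∀ j, j ≤ τ → w j = w 0)
    (hrec : ∀ j, τ ≤ j → w (j + 1) = w j - η • (A.mulVec (w (j - τ)) + b))
    (k : ℕ) (hk : ((τ : ℝ) + 1) * Real.log (2 * ((τ : ℝ) + 1)) ≤ (k : ℝ)) :
    F (w k) - F wstar ≤ 5 * mu * (1 - η * lam) ^ (2 * (k + 1)) * (eNorm (w 0 - wstar)) ^ 2 := by
  have hmu : 0 < mu := hlam.trans_le hlm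
  have hgrad : A.mulVec wstar + b = 0 :=
    mulVec_add_eq_zero_of_minimizer hA hPSD b wstar fun v => by
      have := hmin v
      rw [hF, hF] at this
      linarith
  have hb : b = -A.mulVec wstar := (neg_eq_of_add_eq_zero_right hgrad).symm
  set y : ℕ → Fin d → ℝ := fun j i => (hA.eigenvectorBasis i).ofLp ⬝ᵥ (w j - wstar) with hy
  have hgap : F (w k) - F wstar = (1 / 2) * ∑ i, hA.eigenvalues i * y k i ^ 2 := by
    have h1 : F (w k) - F wstar = (1 / 2) * ((w k - wstar) ⬝ᵥ A.mulVec (w k - wstar)) := by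
      rw [hF, hF, hb]
      simp only [mulVec_sub, dotProduct_sub, sub_dotProduct, neg_dotProduct]
      rw [dotProduct_mulVec_comm_of_isHermitian hA wstar (w k),
        dotProduct_comm (w k) (A.mulVec wstar), dotProduct_comm wstar (A.mulVec wstar)]
      ring
    rw [h1, dotProduct_eq_sum_eigenvectorBasis hA]
    congr 1
    refine Finset.sum_congr rfl fun i _ => ?_
    rw [eigenvectorBasis_dotProduct_mulVec]
    ring
  have hnorm : eNorm (w 0 - wstar) ^ 2 = ∑ i, y 0 i ^ 2 := by
    rw [eNorm, Real.sq_sqrt (Finset.sum_nonneg fun i _ => sq_nonneg _)]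
    have h := dotProduct_eq_sum_eigenvectorBasis hA (w 0 - wstar) (w 0 - wstar)
    simp only [← sq] at h
    rw [← h]
    exact Finset.sum_congr rfl fun i _ => sq _
  have hstep : 20 * (η * mu) * ((τ : ℝ) + 1) ≤ 1 := by
    rw [le_div_iff₀ (by positivity)] at hη2
    linarith
  rw [hgap, hnorm, Finset.mul_sum, Finset.mul_sum]
  refine Finset.sum_le_sum fun i _ => ?_
  obtain ⟨hl, hm⟩ := heig i
  set a := hA.eigenvalues i with ha
  have ha0 : 0 ≤ a := hlam.le.trans hl
  have hηa : η * a ≤ η * mu := mul_le_mul_of_nonneg_left hm hη.le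
  have hτ : (1 : ℝ) ≤ τ + 1 := by linarith [(τ.cast_nonneg : (0 : ℝ) ≤ τ)]
  have hbound : |y k i| ≤ 2 * (1 - η * a) ^ (k + 1) * |y 0 i| := by
    refine delayed_scalar_abs_bound τ (η * a) (by positivity) ?_ (fun j => y j i) ?_ ?_ k
    · exact (mul_le_mul_of_nonneg_right (by linarith) (by linarith)).trans hstep
    · intro j hj
      simp only [hy, hinit j hj]
    · intro j hj
      have hvec : w (j + 1) - wstar
          = (w j - wstar) - η • A.mulVec (w (j - τ) - wstar) := by
        rw [hrec j hj, hb, mulVec_sub, sub_eq_add_neg (A.mulVec _)]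
        abel
      simp only [hy, hvec]
      rw [dotProduct_sub, dotProduct_smul, eigenvectorBasis_dotProduct_mulVec, smul_eq_mul]
      ring
  have hsmall : η * a ≤ 1 := by nlinarith [mul_pos hη hmu]
  have hpow : (1 - η * a) ^ (k + 1) ≤ (1 - η * lam) ^ (k + 1) :=
    pow_le_pow_left₀ (by linarith) (by linarith [mul_le_mul_of_nonneg_left hl hη.le]) _
  have hsq : y k i ^ 2 ≤ 4 * (1 - η * lam) ^ (2 * (k + 1)) * y 0 i ^ 2 := by
    have h1 : |y k i| ≤ 2 * (1 - η * lam) ^ (k + 1) * |y 0 i| :=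
      hbound.trans (by gcongr)
    calc y k i ^ 2 = |y k i| ^ 2 := (sq_abs _).symm
      _ ≤ (2 * (1 - η * lam) ^ (k + 1) * |y 0 i|) ^ 2 := by gcongr
      _ = 4 * (1 - η * lam) ^ (2 * (k + 1)) * y 0 i ^ 2 := by
        rw [mul_pow, mul_pow, sq_abs, ← pow_mul, mul_comm (k + 1) 2]
        norm_num
  have hP : 0 ≤ (1 - η * lam) ^ (2 * (k + 1)) * y 0 i ^ 2 := by
    rw [pow_mul]
    positivity
  nlinarith [mul_le_mul hm hsq (sq_nonneg _) hmu.le, mul_nonneg hmu.le hP]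
end

section
/- Let F(w) = (1/2)wᵀAw + bᵀw + c be a quadratic function on ℝ^d where A is a symmetric positive semidefinite matrix all of whose eigenvalues lie in [0, μ] with μ > 0, and suppose F attains a minimizer w*. Let τ ≥ 0 be an integer, let η ∈ (0, 1/(20μ(τ+1))], and let the iterates of delayed gradient descent be defined by w_0 = w_1 = … = w_τ and w_{k+1} = w_k − η∇F(w_{k−τ}) for k ≥ τ. Then for every k ≥ (τ+1)·ln(2(τ+1)), F(w_k) − F(w*) ≤ (9/(4e·η·(k+1)))·‖w_0 − w*‖², where e is Euler's number. -/
open Matrix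

/-- A delayed scalar gradient recursion with nonnegative constant initial history and small step
stays nonnegative, and each step contracts by a factor between `1 - 2 * a` and `1`. -/
lemma delayed_recursion_bounds {τ : ℕ} {a : ℝ} (ha : 0 ≤ a) (haτ : a * (20 * (τ + 1)) ≤ 1)
    {x : ℕ → ℝ} (hx0 : 0 ≤ x 0) (hinit : ∀ j, j ≤ τ → x j = x 0)
    (hrec : ∀ j, τ ≤ j → x (j + 1) = x j - a * x (j - τ)) (j : ℕ) :
    0 ≤ x j ∧ x (j + 1) ≤ x j ∧ (1 - 2 * a) * x j ≤ x (j + 1) := by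
  have haτ' : 0 ≤ a * τ := by positivity
  have hρ0 : 0 ≤ 1 - 2 * a := by nlinarith
  have hρ : 1 / 2 ≤ (1 - 2 * a) ^ τ := by
    have := one_add_mul_le_pow (a := -(2 * a)) (by nlinarith) τ
    rw [← sub_eq_add_neg] at this
    nlinarith
  induction j using Nat.strong_induction_on with
  | _ j ih =>
    have hj0 : 0 ≤ x j := by
      rcases j with _ | j
      · exact hx0
      · obtain ⟨h1, -, h3⟩ := ih j (Nat.lt_succ_self j)
        exact (mul_nonneg hρ0 h1).trans h3
    refine ⟨hj0, ?_⟩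
    by_cases hj : τ ≤ j
    · have hpow : ∀ m, m ≤ τ → (1 - 2 * a) ^ m * x (j - τ) ≤ x (j - τ + m) := by
        intro m hm
        induction m with
        | zero => simp
        | succ m ihm =>
          have h3 := (ih (j - τ + m) (by omega)).2.2
          calc (1 - 2 * a) ^ (m + 1) * x (j - τ)
              = (1 - 2 * a) * ((1 - 2 * a) ^ m * x (j - τ)) := by ring
            _ ≤ (1 - 2 * a) * x (j - τ + m) :=
                mul_le_mul_of_nonneg_left (ihm (by omega)) hρ0
            _ ≤ x (j - τ + (m + 1)) := h3
      have hp := hpow τ le_rfl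
      rw [Nat.sub_add_cancel hj] at hp
      have hd0 : 0 ≤ x (j - τ) := by
        by_cases h : j - τ < j
        · exact (ih _ h).1
        · rwa [show j - τ = j by omega]
      have hhalf : 1 / 2 * x (j - τ) ≤ x j :=
        (mul_le_mul_of_nonneg_right hρ hd0).trans hp
      rw [hrec j hj]
      constructor
      · nlinarith [mul_nonneg ha hd0]
      · nlinarith [mul_le_mul_of_nonneg_left hhalf ha]
    · rw [hinit (j + 1) (by omega), hinit j (by omega)]
      constructor
      · exact le_rfl
      · nlinarith [mul_nonneg ha hx0]

/-- Exponential decay of a delayed scalar gradient recursion after the initial history. -/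
lemma delayed_recursion_decay {τ : ℕ} {a : ℝ} (ha : 0 ≤ a) (haτ : a * (20 * (τ + 1)) ≤ 1)
    {x : ℕ → ℝ} (hx0 : 0 ≤ x 0) (hinit : ∀ j, j ≤ τ → x j = x 0)
    (hrec : ∀ j, τ ≤ j → x (j + 1) = x j - a * x (j - τ)) (m : ℕ) :
    x (τ + m) ≤ Real.exp (-(a * m)) * x 0 := by
  have hb := delayed_recursion_bounds ha haτ hx0 hinit hrec
  have hanti : Antitone x := antitone_nat_of_succ_le fun j => (hb j).2.1
  induction m with
  | zero => simp [hinit τ le_rfl]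
  | succ m ih =>
    have h1 : x (τ + m) ≤ x (τ + m - τ) := hanti (Nat.sub_le _ _)
    have h2 : 1 - a ≤ Real.exp (-a) := by linarith [Real.add_one_le_exp (-a)]
    calc x (τ + (m + 1)) = x (τ + m) - a * x (τ + m - τ) := hrec (τ + m) (Nat.le_add_right _ _)
      _ ≤ (1 - a) * x (τ + m) := by nlinarith [mul_le_mul_of_nonneg_left h1 ha]
      _ ≤ Real.exp (-a) * x (τ + m) := mul_le_mul_of_nonneg_right h2 (hb _).1
      _ ≤ Real.exp (-a) * (Real.exp (-(a * m)) * x 0) :=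
          mul_le_mul_of_nonneg_left ih (Real.exp_pos _).le
      _ = Real.exp (-(a * (m + 1 : ℕ))) * x 0 := by
          rw [← mul_assoc, ← Real.exp_add]
          push_cast
          ring_nf

lemma delayed_recursion_sq_le_of_nonneg {τ : ℕ} {a : ℝ} (ha : 0 ≤ a)
    (haτ : a * (20 * (τ + 1)) ≤ 1) {x : ℕ → ℝ} (hx0 : 0 ≤ x 0)
    (hinit : ∀ j, j ≤ τ → x j = x 0)
    (hrec : ∀ j, τ ≤ j → x (j + 1) = x j - a * x (j - τ)) (k : ℕ) :
    a * (k + 1) * x k ^ 2 ≤ x 0 ^ 2 := by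
  rcases le_total k τ with hk | hk
  · rw [hinit k hk]
    have hk' : (k : ℝ) ≤ τ := by exact_mod_cast hk
    have : a * (k + 1) ≤ 1 := by nlinarith [mul_nonneg ha (Nat.cast_nonneg (α := ℝ) τ)]
    nlinarith [sq_nonneg (x 0)]
  · obtain ⟨m, rfl⟩ := Nat.exists_eq_add_of_le hk
    have hnonneg := (delayed_recursion_bounds ha haτ hx0 hinit hrec (τ + m)).1
    have hdecay := delayed_recursion_decay ha haτ hx0 hinit hrec m
    have ham : 0 ≤ a * m := by positivity
    have hsq : x (τ + m) ^ 2 ≤ Real.exp (-(2 * (a * m))) * x 0 ^ 2 := by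
      calc x (τ + m) ^ 2 ≤ (Real.exp (-(a * m)) * x 0) ^ 2 := pow_le_pow_left₀ hnonneg hdecay 2
        _ = Real.exp (-(2 * (a * m))) * x 0 ^ 2 := by
          rw [mul_pow, ← Real.exp_nat_mul]
          push_cast
          ring_nf
    have hc : a * ((τ + m : ℕ) + 1) ≤ Real.exp (2 * (a * m)) := by
      push_cast
      nlinarith [Real.add_one_le_exp (2 * (a * m)), mul_nonneg ha (Nat.cast_nonneg (α := ℝ) τ)]
    calc a * ((τ + m : ℕ) + 1) * x (τ + m) ^ 2
        ≤ Real.exp (2 * (a * m)) * (Real.exp (-(2 * (a * m))) * x 0 ^ 2) :=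
          mul_le_mul hc hsq (sq_nonneg _) (Real.exp_pos _).le
      _ = x 0 ^ 2 := by rw [← mul_assoc, ← Real.exp_add]; simp

/-- A delayed scalar gradient recursion satisfies `a * x k ^ 2 = O(1 / k)`. -/
lemma delayed_recursion_sq_le {τ : ℕ} {a : ℝ} (ha : 0 ≤ a)
    (haτ : a * (20 * (τ + 1)) ≤ 1) {x : ℕ → ℝ} (hinit : ∀ j, j ≤ τ → x j = x 0)
    (hrec : ∀ j, τ ≤ j → x (j + 1) = x j - a * x (j - τ)) (k : ℕ) :
    a * (k + 1) * x k ^ 2 ≤ x 0 ^ 2 := by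
  rcases le_total 0 (x 0) with hx0 | hx0
  · exact delayed_recursion_sq_le_of_nonneg ha haτ hx0 hinit hrec k
  · simpa using delayed_recursion_sq_le_of_nonneg (x := fun j => -x j) ha haτ (by simpa using hx0)
      (fun j hj => by simp [hinit j hj]) (fun j hj => by simp only [hrec j hj]; ring) k

/-- Expansion of a quadratic function around a point. -/
lemma quadratic_add {n : Type*} [Fintype n] {A : Matrix n n ℝ} (hA : A.IsHermitian)
    (b : n → ℝ) (c : ℝ) (u v : n → ℝ) :
    (1 / 2) * ((u + v) ⬝ᵥ A *ᵥ (u + v)) + b ⬝ᵥ (u + v) + c =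
      ((1 / 2) * (u ⬝ᵥ A *ᵥ u) + b ⬝ᵥ u + c) + (A *ᵥ u + b) ⬝ᵥ v
        + (1 / 2) * (v ⬝ᵥ A *ᵥ v) := by
  have hT : Aᵀ = A := by simpa [conjTranspose_eq_transpose_of_trivial] using hA.eq
  have hsymm : u ⬝ᵥ A *ᵥ v = v ⬝ᵥ A *ᵥ u := by
    rw [dotProduct_mulVec, ← mulVec_transpose, hT, dotProduct_comm]
  simp only [mulVec_add, dotProduct_add, add_dotProduct, hsymm, dotProduct_comm (A *ᵥ u) v]
  ring

/-- The gradient of a convex quadratic function vanishes at a minimizer. -/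
lemma quadratic_gradient_eq_zero {n : Type*} [Fintype n] {A : Matrix n n ℝ}
    (hA : A.PosSemidef) (b : n → ℝ) (c : ℝ) (u : n → ℝ)
    (hmin : ∀ v, (1 / 2) * (u ⬝ᵥ A *ᵥ u) + b ⬝ᵥ u + c ≤
      (1 / 2) * (v ⬝ᵥ A *ᵥ v) + b ⬝ᵥ v + c) :
    A *ᵥ u + b = 0 := by
  set g := A *ᵥ u + b with hg
  have hQ : 0 ≤ g ⬝ᵥ A *ᵥ g := by simpa using hA.dotProduct_mulVec_nonneg g
  have hG : 0 ≤ g ⬝ᵥ g := by simpa using dotProduct_star_self_nonneg g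
  have key : ∀ t : ℝ, 0 ≤ t * (g ⬝ᵥ g) + 1 / 2 * t ^ 2 * (g ⬝ᵥ A *ᵥ g) := by
    intro t
    have h := hmin (u + t • g)
    rw [quadratic_add hA.isHermitian, ← hg] at h
    simp only [mulVec_smul, dotProduct_smul, smul_dotProduct, smul_eq_mul] at h
    linarith
  refine dotProduct_self_eq_zero.mp (le_antisymm ?_ hG)
  by_contra! hpos
  have hQ1 : 0 < g ⬝ᵥ A *ᵥ g + 1 := by linarith
  have hr : 0 < (g ⬝ᵥ g) / (g ⬝ᵥ A *ᵥ g + 1) := by positivity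
  have hmul : (g ⬝ᵥ g) / (g ⬝ᵥ A *ᵥ g + 1) * (g ⬝ᵥ A *ᵥ g + 1) = g ⬝ᵥ g :=
    div_mul_cancel₀ _ hQ1.ne'
  set r := (g ⬝ᵥ g) / (g ⬝ᵥ A *ᵥ g + 1)
  nlinarith [key (-r), mul_pos hr hr, mul_pos hr hpos]

/-- Orthonormal eigencoordinates of a real symmetric matrix: a linear map that diagonalizes the
matrix and its quadratic form, and preserves the sum of squares. -/
lemma exists_eigencoordinates {n : Type*} [Fintype n] [DecidableEq n] {A : Matrix n n ℝ}
    (hA : A.IsHermitian) :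
    ∃ y : (n → ℝ) →ₗ[ℝ] (n → ℝ),
      (∀ v, v ⬝ᵥ A *ᵥ v = ∑ i, hA.eigenvalues i * y v i ^ 2) ∧
      (∀ v, ∑ i, y v i ^ 2 = ∑ i, v i ^ 2) ∧
      ∀ v i, y (A *ᵥ v) i = hA.eigenvalues i * y v i := by
  obtain ⟨U, hU⟩ : ∃ U : Matrix n n ℝ, U = hA.eigenvectorUnitary := ⟨_, rfl⟩
  have hUU : U * Uᵀ = 1 := by
    simpa [hU, star_eq_conjTranspose, conjTranspose_eq_transpose_of_trivial] using
      Unitary.coe_mul_star_self hA.eigenvectorUnitary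
  have hUU' : Uᵀ * U = 1 := mul_eq_one_comm.mp hUU
  have hspec : A = U * diagonal hA.eigenvalues * Uᵀ := by
    have h := hA.spectral_theorem
    simpa [hU, Unitary.conjStarAlgAut_apply, star_eq_conjTranspose,
      conjTranspose_eq_transpose_of_trivial, Function.comp_def] using h
  have hdot : ∀ u v : n → ℝ, (Uᵀ *ᵥ u) ⬝ᵥ (Uᵀ *ᵥ v) = u ⬝ᵥ v := fun u v => by
    rw [dotProduct_mulVec, vecMul_transpose, mulVec_mulVec, hUU, one_mulVec]
  have hdiag : ∀ v i, (Uᵀ *ᵥ (A *ᵥ v)) i = hA.eigenvalues i * (Uᵀ *ᵥ v) i := fun v i => by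
    have h : Uᵀ * A = diagonal hA.eigenvalues * Uᵀ := by
      conv_lhs => rw [hspec]
      rw [mul_assoc, ← mul_assoc, hUU', one_mul]
    rw [mulVec_mulVec, h, ← mulVec_mulVec, mulVec_diagonal]
  refine ⟨Uᵀ.mulVecLin, fun v => ?_, fun v => ?_, hdiag⟩
  · rw [← hdot, dotProduct]
    exact Finset.sum_congr rfl fun i _ => by rw [hdiag, mulVecLin_apply]; ring
  · simpa only [mulVecLin_apply, dotProduct, ← sq] using hdot v v

/-- **Theorem 2 (deterministic delayed gradient descent, smooth convex case).**
If all eigenvalues of the symmetric PSD matrix `A` lie in `[0, mu]` with `mu > 0`,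
`F w = (1/2) wᵀAw + bᵀw + c`, `wstar` minimizes `F`, `η ∈ (0, 1/(20 mu (τ+1))]`, and the
iterates satisfy `w_0 = … = w_τ` and `w_{k+1} = w_k - η ∇F(w_{k-τ})`, then for every
`k ≥ (τ+1) ln(2(τ+1))`, `F(w_k) - F(wstar) ≤ (9/(4 e η (k+1))) ‖w_0 - wstar‖²`. -/
theorem dgd_convex {d : ℕ} (A : Matrix (Fin d) (Fin d) ℝ)
    (hA : A.IsHermitian) (hPSD : A.PosSemidef)
    (b : Fin d → ℝ) (c : ℝ) (mu : ℝ) (hmu : 0 < mu)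
    (heig : ∀ i, 0 ≤ hA.eigenvalues i ∧ hA.eigenvalues i ≤ mu)
    (F : (Fin d → ℝ) → ℝ)
    (hF : ∀ v, F v = (1 / 2) * (v ⬝ᵥ A.mulVec v) + b ⬝ᵥ v + c)
    (wstar : Fin d → ℝ) (hmin : ∀ v, F wstar ≤ F v)
    (τ : ℕ) (η : ℝ) (hη : 0 < η) (hη2 : η ≤ 1 / (20 * mu * (τ + 1)))
    (w : ℕ → (Fin d → ℝ))
    (hinit : ∀ j, j ≤ τ → w j = w 0)
    (hrec : ∀ j, τ ≤ j → w (j + 1) = w j - η • (A.mulVec (w (j - τ)) + b))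
    (k : ℕ) (hk : ((τ : ℝ) + 1) * Real.log (2 * ((τ : ℝ) + 1)) ≤ (k : ℝ)) :
    F (w k) - F wstar ≤
      9 / (4 * Real.exp 1 * η * ((k : ℝ) + 1)) * (eNorm (w 0 - wstar)) ^ 2 := by
  have hgrad : A *ᵥ wstar + b = 0 :=
    quadratic_gradient_eq_zero hPSD b c wstar fun v => by simpa only [← hF] using hmin v
  have hgap : F (w k) - F wstar = 1 / 2 * ((w k - wstar) ⬝ᵥ A *ᵥ (w k - wstar)) := by
    have h := quadratic_add hA b c wstar (w k - wstar)
    rw [hgrad, ← hF, ← hF, zero_dotProduct, add_sub_cancel] at h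
    linarith
  have hstep : ∀ j, τ ≤ j → w (j + 1) - wstar = w j - wstar - η • A *ᵥ (w (j - τ) - wstar) := by
    intro j hj
    rw [hrec j hj, mulVec_sub, eq_neg_of_add_eq_zero_left hgrad, sub_neg_eq_add]
    abel
  obtain ⟨y, hyA, hyI, hyR⟩ := exists_eigencoordinates hA
  have hcoord : ∀ i, η * hA.eigenvalues i * (k + 1) * y (w k - wstar) i ^ 2 ≤
      y (w 0 - wstar) i ^ 2 := by
    intro i
    refine delayed_recursion_sq_le (τ := τ) (x := fun j => y (w j - wstar) i)
      (mul_nonneg hη.le (heig i).1) ?_ (fun j hj => by rw [hinit j hj]) (fun j hj => ?_) k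
    · rw [le_div_iff₀ (by positivity)] at hη2
      have := mul_le_mul_of_nonneg_left (heig i).2 (show 0 ≤ η * (20 * ((τ : ℝ) + 1)) by positivity)
      linarith
    · simp only [hstep j hj, map_sub, map_smul, Pi.sub_apply, Pi.smul_apply, smul_eq_mul, hyR]
      ring
  have hnorm : eNorm (w 0 - wstar) ^ 2 = ∑ i, y (w 0 - wstar) i ^ 2 := by
    rw [hyI, eNorm, Real.sq_sqrt (Finset.sum_nonneg fun i _ => sq_nonneg _)]
  have hbound : 2 * (η * (k + 1)) * (F (w k) - F wstar) ≤ eNorm (w 0 - wstar) ^ 2 := by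
    rw [hgap, hyA, hnorm]
    calc _ = ∑ i, η * hA.eigenvalues i * (k + 1) * y (w k - wstar) i ^ 2 := by
          rw [Finset.mul_sum, Finset.mul_sum]
          exact Finset.sum_congr rfl fun i _ => by ring
      _ ≤ _ := Finset.sum_le_sum fun i _ => hcoord i
  have he : Real.exp 1 ≤ 9 / 2 := by linarith [Real.exp_one_lt_d9]
  have hpos : 0 < 4 * Real.exp 1 * η * ((k : ℝ) + 1) := by positivity
  rw [div_mul_eq_mul_div, le_div_iff₀ hpos]
  nlinarith [mul_le_mul_of_nonneg_left hbound (Real.exp_pos 1).le,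
    mul_le_mul_of_nonneg_right he (sq_nonneg (eNorm (w 0 - wstar)))]
end

section
/- Fix μ > 0 and an integer delay τ ≥ 0. For every integer k with τ + 1 ≤ k ≤ (1/2)(d − 1)(τ + 1), there exists a μ-smooth convex quadratic function F on ℝ^d with minimizer w* such that: every sequence of iterates (w_j) satisfying w_0 = w_1 = … = w_τ = 0 and, for all j ≥ τ, w_{j+1} ∈ span{∇F(w_0), ∇F(w_1), …, ∇F(w_{j−τ})}, obeys F(w_k) − F(w*) ≥ μ(τ+1)²·‖w_0 − w*‖²/(45k²). -/
open Matrix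

/-- The quadratic function `w ↦ (1/2) wᵀAw + bᵀw + c`. -/
noncomputable def quadF {d : ℕ} (A : Matrix (Fin d) (Fin d) ℝ) (b : Fin d → ℝ) (c : ℝ)
    (v : Fin d → ℝ) : ℝ := (1 / 2) * (v ⬝ᵥ A.mulVec v) + b ⬝ᵥ v + c

/-- The map sending `w` to the increments of the sequence `0, w 0, …, w (n - 1), 0`;
the coordinates of `w` from `n` on are ignored. -/
def incrMatrix (n d : ℕ) : Matrix (Fin (n + 1)) (Fin d) ℝ :=
  Matrix.of fun i j =>
    if (j : ℕ) < n then
      (if (i : ℕ) = j then 1 else 0) - (if (i : ℕ) = j + 1 then 1 else 0)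
    else 0

theorem incrMatrix_transpose_mulVec (n d : ℕ) (y : ℕ → ℝ) (j : Fin d) :
    ((incrMatrix n d)ᵀ *ᵥ fun i => y i) j = if (j : ℕ) < n then y j - y (j + 1) else 0 := by
  simp only [mulVec, dotProduct, transpose_apply, incrMatrix, of_apply]
  split_ifs with h
  · rw [Fin.sum_univ_eq_sum_range (fun i : ℕ =>
      ((if i = (j : ℕ) then (1 : ℝ) else 0) - (if i = (j : ℕ) + 1 then 1 else 0)) * y i)]
    simp only [sub_mul, ite_mul, one_mul, zero_mul, Finset.sum_sub_distrib, Finset.sum_ite_eq',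
      Finset.mem_range]
    rw [if_pos (by omega), if_pos (by omega)]
  · simp

theorem incrMatrix_mulVec {n d : ℕ} (hnd : n ≤ d) (x : ℕ → ℝ) (i : Fin (n + 1)) :
    (incrMatrix n d *ᵥ fun j => x j) i =
      (if (i : ℕ) < n then x i else 0) - (if 1 ≤ (i : ℕ) then x (i - 1) else 0) := by
  simp only [mulVec, dotProduct, incrMatrix, of_apply]
  rw [Fin.sum_univ_eq_sum_range (fun j : ℕ => (if j < n then
      ((if (i : ℕ) = j then (1 : ℝ) else 0) - (if (i : ℕ) = j + 1 then 1 else 0)) else 0) * x j)]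
  have hi := i.isLt
  have hterm : ∀ j ∈ Finset.range d, (if j < n then
      ((if (i : ℕ) = j then (1 : ℝ) else 0) - (if (i : ℕ) = j + 1 then 1 else 0)) else 0) * x j =
      (if (i : ℕ) = j then (if (i : ℕ) < n then x i else 0) else 0) -
      (if (i : ℕ) - 1 = j then (if 1 ≤ (i : ℕ) then x (i - 1) else 0) else 0) := by
    intro j _
    by_cases h1 : (i : ℕ) = j
    · subst h1
      by_cases h2 : 1 ≤ (i : ℕ)
      · have : ¬ ((i : ℕ) - 1 = i) := by omega
        simp [this]
      · simp [h2]
    · by_cases h2 : (i : ℕ) = j + 1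
      · have : j < n := by omega
        simp [h2, this]
      · by_cases h3 : 1 ≤ (i : ℕ)
        · have : ¬ ((i : ℕ) - 1 = j) := by omega
          simp [h1, h2, this]
        · simp [h1, h2, h3]
  rw [Finset.sum_congr rfl hterm, Finset.sum_sub_distrib, Finset.sum_ite_eq, Finset.sum_ite_eq]
  simp only [Finset.mem_range]
  congr 1
  · split_ifs <;> first | rfl | omega
  · split_ifs <;> first | rfl | omega

theorem exists_nat_extension {d : ℕ} (v : Fin d → ℝ) :
    ∃ x : ℕ → ℝ, v = fun j : Fin d => x j :=
  ⟨fun j => if h : j < d then v ⟨j, h⟩ else 0, by ext j; simp⟩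

theorem incrMatrix_mulVec_norm_le {n d : ℕ} (hnd : n ≤ d) (v : Fin d → ℝ) :
    (incrMatrix n d *ᵥ v) ⬝ᵥ (incrMatrix n d *ᵥ v) ≤ 4 * (v ⬝ᵥ v) := by
  obtain ⟨x, rfl⟩ := exists_nat_extension v
  have hfst : ∑ i : Fin (n + 1), (if (i : ℕ) < n then x i else 0) ^ 2 =
      ∑ i ∈ Finset.range n, x i ^ 2 := by
    rw [Fin.sum_univ_castSucc]
    simp [Fin.sum_univ_eq_sum_range (fun i => x i ^ 2)]
  have hsnd : ∑ i : Fin (n + 1), (if 1 ≤ (i : ℕ) then x (i - 1) else 0) ^ 2 =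
      ∑ i ∈ Finset.range n, x i ^ 2 := by
    rw [Fin.sum_univ_succ]
    simp [Fin.sum_univ_eq_sum_range (fun i => x i ^ 2)]
  have hle : ∑ i ∈ Finset.range n, x i ^ 2 ≤ ∑ i ∈ Finset.range d, x i ^ 2 :=
    Finset.sum_le_sum_of_subset_of_nonneg (Finset.range_mono hnd) fun _ _ _ => sq_nonneg _
  have hv : (fun j : Fin d => x j) ⬝ᵥ (fun j : Fin d => x j) = ∑ i ∈ Finset.range d, x i ^ 2 := by
    simp only [dotProduct, ← sq]
    exact Fin.sum_univ_eq_sum_range (fun i => x i ^ 2) d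
  have hB : (incrMatrix n d *ᵥ fun j => x j) ⬝ᵥ (incrMatrix n d *ᵥ fun j => x j) ≤
      ∑ i : Fin (n + 1), (2 * (if (i : ℕ) < n then x i else 0) ^ 2 +
        2 * (if 1 ≤ (i : ℕ) then x (i - 1) else 0) ^ 2) := by
    refine Finset.sum_le_sum fun i _ => ?_
    rw [incrMatrix_mulVec hnd]
    nlinarith [sq_nonneg ((if (i : ℕ) < n then x i else 0) +
      (if 1 ≤ (i : ℕ) then x (i - 1) else 0))]
  rw [Finset.sum_add_distrib, ← Finset.mul_sum, ← Finset.mul_sum, hfst, hsnd] at hB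
  linarith

/-- The Hessian of the worst-case quadratic function. -/
noncomputable def hardHessian (mu : ℝ) (n d : ℕ) : Matrix (Fin d) (Fin d) ℝ :=
  (mu / 4) • ((incrMatrix n d)ᵀ * incrMatrix n d)

/-- The linear term of the worst-case quadratic function. -/
noncomputable def hardLinear (mu : ℝ) (d : ℕ) : Fin d → ℝ :=
  fun j => if (j : ℕ) = 0 then -(mu / 4) else 0

/-- The minimizer of the worst-case quadratic function. -/
noncomputable def hardMin (n d : ℕ) : Fin d → ℝ :=
  fun j => if (j : ℕ) < n then 1 - ((j : ℝ) + 1) / ((n : ℝ) + 1) else 0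

theorem hardHessian_mulVec (mu : ℝ) (n d : ℕ) (v : Fin d → ℝ) :
    hardHessian mu n d *ᵥ v = (mu / 4) • ((incrMatrix n d)ᵀ *ᵥ (incrMatrix n d *ᵥ v)) := by
  rw [hardHessian, smul_mulVec, mulVec_mulVec]

theorem dotProduct_hardHessian_mulVec (mu : ℝ) (n d : ℕ) (v : Fin d → ℝ) :
    v ⬝ᵥ (hardHessian mu n d *ᵥ v) =
      mu / 4 * ((incrMatrix n d *ᵥ v) ⬝ᵥ (incrMatrix n d *ᵥ v)) := by
  rw [hardHessian_mulVec, dotProduct_smul, dotProduct_mulVec, vecMul_transpose, smul_eq_mul]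

theorem hardHessian_posSemidef {mu : ℝ} (hmu : 0 ≤ mu) (n d : ℕ) :
    (hardHessian mu n d).PosSemidef := by
  have h := posSemidef_conjTranspose_mul_self (incrMatrix n d)
  rw [conjTranspose_eq_transpose_of_trivial] at h
  exact h.smul (by positivity)

theorem Matrix.IsHermitian.eigenvalues_le_of_dotProduct_mulVec_le {d : ℕ}
    {A : Matrix (Fin d) (Fin d) ℝ} (hA : A.IsHermitian) {mu : ℝ}
    (h : ∀ v, v ⬝ᵥ (A *ᵥ v) ≤ mu * (v ⬝ᵥ v)) (i : Fin d) : hA.eigenvalues i ≤ mu := by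
  have hunit : (hA.eigenvectorBasis i : Fin d → ℝ) ⬝ᵥ (hA.eigenvectorBasis i : Fin d → ℝ) = 1 := by
    have hn := hA.eigenvectorBasis.orthonormal.1 i
    have := EuclideanSpace.real_norm_sq_eq (hA.eigenvectorBasis i)
    rw [hn] at this
    simpa [dotProduct, sq] using this.symm
  have hi := h (hA.eigenvectorBasis i)
  rwa [hA.mulVec_eigenvectorBasis, dotProduct_smul, hunit, smul_eq_mul, mul_one, mul_one] at hi

theorem hardHessian_mulVec_hardMin (mu : ℝ) {n d : ℕ} (hn : 0 < n) (hnd : n ≤ d) :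
    hardHessian mu n d *ᵥ hardMin n d = -hardLinear mu d := by
  have hincr : incrMatrix n d *ᵥ hardMin n d =
      fun i : Fin (n + 1) =>
        (fun i : ℕ => (if i = 0 then (1 : ℝ) else 0) - 1 / ((n : ℝ) + 1)) i := by
    ext i
    have := incrMatrix_mulVec hnd
      (fun j : ℕ => if j < n then 1 - ((j : ℝ) + 1) / ((n : ℝ) + 1) else 0) i
    refine this.trans ?_
    have hi := i.isLt
    have hpos : (n : ℝ) + 1 ≠ 0 := by positivity
    rcases Nat.eq_zero_or_pos (i : ℕ) with h | h
    · simp [h, hn]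
    · obtain ⟨m, hm⟩ : ∃ m, (i : ℕ) = m + 1 := ⟨i - 1, by omega⟩
      simp only [hm]
      have hmn : m < n := by omega
      by_cases h2 : m + 1 < n
      · simp [h2, hmn]
        field_simp
        ring
      · have : n = m + 1 := by omega
        subst this
        simp
        field_simp
        ring
  rw [hardHessian_mulVec, hincr]
  ext j
  rw [Pi.smul_apply, incrMatrix_transpose_mulVec n d
    (fun i : ℕ => (if i = 0 then (1 : ℝ) else 0) - 1 / ((n : ℝ) + 1))]
  by_cases h : (j : ℕ) = 0
  · simp [hardLinear, h, hn]
  · simp [hardLinear, h]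

theorem gradient_apply_eq_zero (mu : ℝ) {n d s : ℕ} {v : Fin d → ℝ}
    (hv : ∀ i : Fin d, s ≤ i → v i = 0) (j : Fin d) (hj : s + 1 ≤ j) :
    (hardHessian mu n d *ᵥ v + hardLinear mu d) j = 0 := by
  have hincr : ∀ i : Fin (n + 1), s + 1 ≤ (i : ℕ) → (incrMatrix n d *ᵥ v) i = 0 := by
    intro i hi
    simp only [mulVec, dotProduct]
    refine Finset.sum_eq_zero fun l _ => ?_
    by_cases hl : s ≤ (l : ℕ)
    · rw [hv l hl, mul_zero]
    · have h1 : ¬ (i : ℕ) = l := by omega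
      have h2 : ¬ (i : ℕ) = l + 1 := by omega
      simp [incrMatrix, h1, h2]
  have hgrad : ((incrMatrix n d)ᵀ *ᵥ (incrMatrix n d *ᵥ v)) j = 0 := by
    rw [mulVec, dotProduct]
    refine Finset.sum_eq_zero fun i _ => ?_
    by_cases hi : s + 1 ≤ (i : ℕ)
    · rw [hincr i hi, mul_zero]
    · have h1 : ¬ (i : ℕ) = j := by omega
      have h2 : ¬ (i : ℕ) = j + 1 := by omega
      simp [incrMatrix, h1, h2]
  have hj0 : ¬ (j : ℕ) = 0 := by omega
  rw [hardHessian_mulVec, Pi.add_apply, Pi.smul_apply, hgrad]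
  simp [hardLinear, hj0]

theorem iterate_apply_eq_zero (mu : ℝ) {n d τ : ℕ} {w : ℕ → Fin d → ℝ}
    (h0 : ∀ j, j ≤ τ → w j = 0)
    (hspan : ∀ j, τ ≤ j → w (j + 1) ∈ Submodule.span ℝ
      {v | ∃ i ≤ j - τ, v = (hardHessian mu n d).mulVec (w i) + hardLinear mu d}) (j : ℕ) :
    ∀ i : Fin d, j / (τ + 1) ≤ i → w j i = 0 := by
  induction j using Nat.strong_induction_on with
  | _ j ih =>
    intro i hi
    rcases Nat.lt_or_ge τ j with hj | hj
    · obtain ⟨m, rfl⟩ : ∃ m, j = m + (τ + 1) := ⟨j - (τ + 1), by omega⟩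
      rw [Nat.add_div_right _ (by omega : 0 < τ + 1)] at hi
      have hle : Submodule.span ℝ
          {v | ∃ i ≤ m + τ - τ, v = (hardHessian mu n d).mulVec (w i) + hardLinear mu d} ≤
          LinearMap.ker (LinearMap.proj (R := ℝ) (φ := fun _ : Fin d => ℝ) i) := by
        rw [Submodule.span_le]
        rintro _ ⟨l, hl, rfl⟩
        have hlm : l / (τ + 1) ≤ m / (τ + 1) := Nat.div_le_div_right (by omega)
        exact gradient_apply_eq_zero mu (ih l (by omega)) i (by omega)
      exact hle (hspan (m + τ) (by omega))
    · rw [h0 j hj, Pi.zero_apply]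

theorem quadF_sub_quadF {d : ℕ} {A : Matrix (Fin d) (Fin d) ℝ} (hA : A.IsSymm)
    {b z : Fin d → ℝ} (hz : A *ᵥ z = -b) (c : ℝ) (v : Fin d → ℝ) :
    quadF A b c v - quadF A b c z = 1 / 2 * ((v - z) ⬝ᵥ (A *ᵥ (v - z))) := by
  obtain rfl : b = -(A *ᵥ z) := by rw [hz, neg_neg]
  have hsymm : z ⬝ᵥ (A *ᵥ v) = v ⬝ᵥ (A *ᵥ z) := by
    rw [dotProduct_mulVec, ← mulVec_transpose, hA.eq, dotProduct_comm]
  simp only [quadF, mulVec_sub, dotProduct_sub, sub_dotProduct, neg_dotProduct, hsymm,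
    dotProduct_comm (A *ᵥ z)]
  ring

theorem le_incrMatrix_mulVec_sub_hardMin {r d : ℕ} (hrd : 2 * r + 1 ≤ d) {v : Fin d → ℝ}
    (hv : ∀ i : Fin d, r ≤ i → v i = 0) :
    1 / (2 * ((r : ℝ) + 1)) ≤
      (incrMatrix (2 * r + 1) d *ᵥ (v - hardMin (2 * r + 1) d)) ⬝ᵥ
        (incrMatrix (2 * r + 1) d *ᵥ (v - hardMin (2 * r + 1) d)) := by
  set n := 2 * r + 1 with hn
  set e := v - hardMin n d with he
  set t : ℝ := 1 / (2 * ((r : ℝ) + 1)) with ht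
  have hpos : (r : ℝ) + 1 ≠ 0 := by positivity
  let y : ℕ → ℝ := fun i => if i ≤ r then -t else t
  have her : e ⟨r, by omega⟩ = -(1 / 2) := by
    have hrn : r < 2 * r + 1 := by omega
    simp only [he, Pi.sub_apply, hv ⟨r, by omega⟩ le_rfl, hardMin, hn, if_pos hrn]
    push_cast
    field_simp
    ring
  have hinner : (incrMatrix n d *ᵥ e) ⬝ᵥ (fun i : Fin (n + 1) => y i) = t := by
    have hcol : ((incrMatrix n d)ᵀ *ᵥ fun i : Fin (n + 1) => y i) =
        Pi.single (⟨r, by omega⟩ : Fin d) (-(2 * t)) := by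
      ext j
      rw [incrMatrix_transpose_mulVec, Pi.single_apply]
      rcases lt_trichotomy (j : ℕ) r with h | h | h
      · have h1 : j ≠ ⟨r, by omega⟩ := fun hh => by simp [hh] at h
        have h2 : (j : ℕ) + 1 ≤ r := h
        simp [y, h1, h.le, h2]
      · have h1 : j = ⟨r, by omega⟩ := Fin.ext h
        have h2 : r < n := by omega
        simp [y, h1, h2]
        ring
      · have h1 : j ≠ ⟨r, by omega⟩ := fun hh => by simp [hh] at h
        have h2 : ¬ (j : ℕ) ≤ r := by omega
        have h3 : ¬ (j : ℕ) + 1 ≤ r := by omega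
        simp [y, h1, h2, h3]
    rw [dotProduct_comm, dotProduct_mulVec, ← mulVec_transpose, hcol, single_dotProduct, her]
    ring
  have hterm : ∑ i : Fin (n + 1), (2 * ((incrMatrix n d *ᵥ e) i * y i) - t ^ 2) ≤
      (incrMatrix n d *ᵥ e) ⬝ᵥ (incrMatrix n d *ᵥ e) := by
    refine Finset.sum_le_sum fun i _ => ?_
    have hy : y i ^ 2 = t ^ 2 := by
      simp only [y]
      split_ifs <;> ring
    nlinarith [sq_nonneg ((incrMatrix n d *ᵥ e) i - y i)]
  rw [Finset.sum_sub_distrib, ← Finset.mul_sum] at hterm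
  rw [dotProduct] at hinner
  rw [hinner] at hterm
  simp only [Finset.sum_const, Finset.card_univ, Fintype.card_fin, nsmul_eq_mul] at hterm
  have hsq : ((n + 1 : ℕ) : ℝ) * t ^ 2 = t := by
    rw [ht, hn]
    push_cast
    field_simp
    ring
  linarith

theorem sum_hardMin_sq_le {n d : ℕ} (hnd : n ≤ d) :
    ∑ i, (hardMin n d i) ^ 2 ≤ ((n : ℝ) + 1) / 3 := by
  have hpos : (0 : ℝ) < (n : ℝ) + 1 := by positivity
  have hsum : ∀ m : ℕ, ∑ i ∈ Finset.range m, ((i : ℝ) + 1) ^ 2 =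
      (m : ℝ) * (m + 1) * (2 * m + 1) / 6 := by
    intro m
    induction m with
    | zero => simp
    | succ m ih => rw [Finset.sum_range_succ, ih]; push_cast; ring
  have hrefl : ∑ i, (hardMin n d i) ^ 2 =
      ∑ i ∈ Finset.range n, ((i : ℝ) + 1) ^ 2 / ((n : ℝ) + 1) ^ 2 := by
    simp only [hardMin]
    rw [Fin.sum_univ_eq_sum_range (fun j : ℕ =>
      (if j < n then 1 - ((j : ℝ) + 1) / ((n : ℝ) + 1) else 0) ^ 2),
      ← Finset.sum_subset (Finset.range_mono hnd), ← Finset.sum_range_reflect]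
    · refine Finset.sum_congr rfl fun j hj => ?_
      have hj := Finset.mem_range.1 hj
      rw [if_pos (by omega), Nat.sub_sub, Nat.cast_sub (by omega)]
      push_cast
      field_simp
      ring
    · intro j _ hj
      rw [Finset.mem_range] at hj
      simp [hj]
  rw [hrefl, ← Finset.sum_div, hsum, div_le_iff₀ (by positivity)]
  have hn0 : (0 : ℝ) ≤ n := by positivity
  nlinarith [mul_nonneg hn0 hn0, mul_nonneg (mul_nonneg hn0 hn0) hn0]

/-- **Lower bound, smooth convex case.** For `mu > 0`, delay `τ`, and any
`τ + 1 ≤ k ≤ (1/2)(d-1)(τ+1)`, there is a `mu`-smooth convex quadratic `F` with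
minimizer `wstar` such that every iterate sequence obeying the delayed linear-span
condition satisfies `F(w_k) - F(wstar) ≥ mu (τ+1)² ‖w_0 - wstar‖² / (45 k²)`. -/
theorem dgd_lower_bound_convex {d : ℕ} (mu : ℝ) (hmu : 0 < mu)
    (τ : ℕ) (k : ℕ) (hk : τ + 1 ≤ k)
    (hkd : (k : ℝ) ≤ (1 / 2) * ((d : ℝ) - 1) * ((τ : ℝ) + 1)) :
    ∃ (A : Matrix (Fin d) (Fin d) ℝ) (b : Fin d → ℝ) (c : ℝ) (hA : A.IsHermitian)
      (wstar : Fin d → ℝ),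
      A.PosSemidef ∧
      (∀ i, 0 ≤ hA.eigenvalues i ∧ hA.eigenvalues i ≤ mu) ∧
      (∀ v, quadF A b c wstar ≤ quadF A b c v) ∧
      ∀ w : ℕ → (Fin d → ℝ),
        (∀ j, j ≤ τ → w j = 0) →
        (∀ j, τ ≤ j →
          w (j + 1) ∈ Submodule.span ℝ {v | ∃ i ≤ j - τ, v = A.mulVec (w i) + b}) →
        mu * ((τ : ℝ) + 1) ^ 2 * (eNorm (w 0 - wstar)) ^ 2 / (45 * (k : ℝ) ^ 2)
          ≤ quadF A b c (w k) - quadF A b c wstar := by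
  set r := k / (τ + 1) with hr
  have hr1 : 1 ≤ r := (Nat.one_le_div_iff (Nat.succ_pos τ)).2 hk
  have hrk : (r : ℝ) * ((τ : ℝ) + 1) ≤ k := by exact_mod_cast Nat.div_mul_le_self k (τ + 1)
  have hτ : (0 : ℝ) < (τ : ℝ) + 1 := by positivity
  have hrd : 2 * r + 1 ≤ d := by
    have h : (r : ℝ) ≤ 1 / 2 * ((d : ℝ) - 1) := le_of_mul_le_mul_right (hrk.trans hkd) hτ
    have h' : 2 * (r : ℝ) + 1 ≤ d := by linarith
    exact_mod_cast h'
  set n := 2 * r + 1 with hn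
  have hpsd := hardHessian_posSemidef hmu.le n d
  have hsymm : (hardHessian mu n d).IsSymm := by
    simpa [IsSymm, IsHermitian, conjTranspose_eq_transpose_of_trivial] using hpsd.isHermitian
  have hmin := hardHessian_mulVec_hardMin mu (Nat.succ_pos (2 * r)) hrd
  have hgap := fun v => quadF_sub_quadF hsymm hmin 0 v
  refine ⟨hardHessian mu n d, hardLinear mu d, 0, hpsd.isHermitian, hardMin n d, hpsd,
    fun i => ⟨hpsd.eigenvalues_nonneg i,
      hpsd.isHermitian.eigenvalues_le_of_dotProduct_mulVec_le (fun v => ?_) i⟩,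
    fun v => ?_, fun w h0 hspan => ?_⟩
  · rw [dotProduct_hardHessian_mulVec]
    nlinarith [incrMatrix_mulVec_norm_le hrd v]
  · rw [← sub_nonneg, hgap, dotProduct_hardHessian_mulVec]
    have : 0 ≤ (incrMatrix n d *ᵥ (v - hardMin n d)) ⬝ᵥ (incrMatrix n d *ᵥ (v - hardMin n d)) :=
      Finset.sum_nonneg fun i _ => mul_self_nonneg _
    positivity
  · have hlow := le_incrMatrix_mulVec_sub_hardMin hrd (iterate_apply_eq_zero mu h0 hspan k)
    have hnorm : eNorm (w 0 - hardMin n d) ^ 2 ≤ 2 * ((r : ℝ) + 1) / 3 := by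
      rw [eNorm, Real.sq_sqrt (Finset.sum_nonneg fun i _ => sq_nonneg _), h0 0 (Nat.zero_le τ)]
      have h := sum_hardMin_sq_le hrd
      simp only [Pi.sub_apply, Pi.zero_apply, zero_sub, neg_sq]
      refine h.trans (le_of_eq ?_)
      rw [hn]
      push_cast
      ring
    rw [hgap, dotProduct_hardHessian_mulVec]
    have hr1' : (1 : ℝ) ≤ r := by exact_mod_cast hr1
    have hk0 : (0 : ℝ) < k := lt_of_lt_of_le (by positivity) hrk
    have hratio : ((τ : ℝ) + 1) ^ 2 / (k : ℝ) ^ 2 ≤ 1 / (r : ℝ) ^ 2 := by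
      rw [div_le_div_iff₀ (by positivity) (by positivity), one_mul, ← mul_pow, mul_comm]
      gcongr
    calc mu * ((τ : ℝ) + 1) ^ 2 * eNorm (w 0 - hardMin n d) ^ 2 / (45 * (k : ℝ) ^ 2)
        = mu / 45 * (((τ : ℝ) + 1) ^ 2 / (k : ℝ) ^ 2) * eNorm (w 0 - hardMin n d) ^ 2 := by
          field_simp
      _ ≤ mu / 45 * (1 / (r : ℝ) ^ 2) * (2 * ((r : ℝ) + 1) / 3) := by gcongr
      _ ≤ mu / 8 * (1 / (2 * ((r : ℝ) + 1))) := by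
          rw [show mu / 45 * (1 / (r : ℝ) ^ 2) * (2 * ((r : ℝ) + 1) / 3) =
            mu * ((2 * ((r : ℝ) + 1)) / (135 * (r : ℝ) ^ 2)) by field_simp; ring,
            show mu / 8 * (1 / (2 * ((r : ℝ) + 1))) = mu * (1 / (16 * ((r : ℝ) + 1))) by
              field_simp; ring]
          refine mul_le_mul_of_nonneg_left ?_ hmu.le
          rw [div_le_div_iff₀ (by positivity) (by positivity)]
          nlinarith
      _ ≤ 1 / 2 * (mu / 4 * ((incrMatrix n d *ᵥ (w k - hardMin n d)) ⬝ᵥ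
            (incrMatrix n d *ᵥ (w k - hardMin n d)))) := by
          nlinarith
end

section
/- Let τ ≥ 1 be an integer, α ∈ [0, 1/τ], and let (b_k)_{k≥0} be a real sequence satisfying b_0 = b_1 = … = b_τ = 1 and b_{k+1} = b_k − α·b_{k−τ} for all k ≥ τ. Then |b_k| ≤ 1 for every k ≥ 0. -/
/-- A real sequence passing from nonpositive to positive has a step at which it crosses zero. -/
theorem exists_zero_crossing {b : ℕ → ℝ} {p q : ℕ} (hpq : p ≤ q) (hp : b p ≤ 0)
    (hq : 0 < b q) : ∃ m, p ≤ m ∧ m < q ∧ b m ≤ 0 ∧ 0 < b (m + 1) := by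
  induction q, hpq using Nat.le_induction with
  | base => linarith
  | succ q hpq ih =>
    by_cases h : b q ≤ 0
    · exact ⟨q, hpq, q.lt_succ_self, h, hq⟩
    · obtain ⟨m, h₁, h₂, h₃⟩ := ih (not_le.mp h)
      exact ⟨m, h₁, h₂.trans q.lt_succ_self, h₃⟩

/-- The upper bound `1` propagates one step along the delayed recurrence, for any initial segment
which is constant. The proof bounds the growth of `b` after its last crossing of zero. -/
theorem delayed_recurrence_succ_le_one {τ : ℕ} (hτ : 1 ≤ τ) {α : ℝ} (hα : 0 ≤ α)
    (hατ : α * τ ≤ 1) {b : ℕ → ℝ} (hconst : ∀ j < τ, b (j + 1) = b j)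
    (hrec : ∀ j, τ ≤ j → b (j + 1) = b j - α * b (j - τ)) {k : ℕ}
    (hb : ∀ j ≤ k, |b j| ≤ 1) : b (k + 1) ≤ 1 := by
  have hτ' : (1 : ℝ) ≤ τ := by exact_mod_cast hτ
  have hk := (abs_le.mp (hb k le_rfl)).2
  rcases lt_or_ge k τ with hkτ | hkτ
  · rwa [hconst k hkτ]
  rcases le_or_gt 0 (b (k - τ)) with hneg | hneg
  · rw [hrec k hkτ]
    nlinarith [mul_nonneg hα hneg]
  rcases le_or_gt (b (k + 1)) 0 with hpos | hpos
  · linarith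
  obtain ⟨m, hm₁, hm₂, hm, hm'⟩ := exists_zero_crossing (by omega) hneg.le hpos
  have hincr : ∀ j ≤ k, b (j + 1) ≤ b j + α := by
    intro j hj
    rcases lt_or_ge j τ with h | h
    · linarith [hconst j h]
    · rw [hrec j h]
      nlinarith [(abs_le.mp (hb (j - τ) (by omega))).1]
  have hmτ : τ ≤ m := by
    by_contra! h
    linarith [hconst m h]
  have hback : ∀ r ≤ m + 1, b (m + 1) - α * r ≤ b (m + 1 - r) := by
    intro r
    induction r with
    | zero => simp
    | succ r ih =>
      intro hr
      have h₁ := ih (by omega)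
      have h₂ := hincr (m + 1 - (r + 1)) (by omega)
      rw [show m + 1 - (r + 1) + 1 = m + 1 - r by omega] at h₂
      rw [Nat.cast_succ]
      linarith
  have hforward : ∀ n ≤ τ, b (m + 1 + n) ≤
      b (m + 1) + α * (α * (n * τ - n * (n - 1) / 2) - n * b (m + 1)) := by
    intro n
    induction n with
    | zero => simp
    | succ n ih =>
      intro hn
      have h₁ := ih (by omega)
      have h₂ := mul_le_mul_of_nonneg_left (hback (τ - n) (by omega)) hα
      rw [Nat.cast_sub (by omega), show m + 1 - (τ - n) = m + 1 + n - τ by omega] at h₂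
      rw [← add_assoc, hrec _ (by omega)]
      push_cast
      linarith
  obtain ⟨n, rfl⟩ := Nat.exists_eq_add_of_le (show m ≤ k by omega)
  have hn : n ≤ τ := by omega
  have hfinal := hforward n hn
  rw [show m + 1 + n = m + n + 1 by omega] at hfinal
  have hc : b (m + 1) ≤ α := by linarith [hincr m (by omega)]
  have hnτ : (n : ℝ) ≤ τ := by exact_mod_cast hn
  have hαn : α * n ≤ 1 := (mul_le_mul_of_nonneg_left hnτ hα).trans hατ
  have h₁ : b (m + 1) * (1 - α * n) ≤ α * (1 - α * n) :=
    mul_le_mul_of_nonneg_right hc (by linarith)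
  have h₂ : (0 : ℝ) ≤ (τ - n) * (τ - n - 1) := by
    rcases hn.eq_or_lt with h | h
    · simp [h]
    · have : (n : ℝ) + 1 ≤ τ := by exact_mod_cast h
      exact mul_nonneg (by linarith) (by linarith)
  have h₃ := mul_nonneg (mul_nonneg hα hα) h₂
  have h₄ : α * (τ - 1) * (α * τ) ≤ α * (τ - 1) * 1 :=
    mul_le_mul_of_nonneg_left hατ (mul_nonneg hα (by linarith))
  have h₅ : α * 1 ≤ α * τ := mul_le_mul_of_nonneg_left hτ' hα
  linarith

/-- **Lemma 2 (boundedness of the delayed scalar recurrence).** For an integer `τ ≥ 1`,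
`α ∈ [0, 1/τ]`, and the sequence with `b_0 = … = b_τ = 1` and
`b_{k+1} = b_k - α b_{k-τ}` for `k ≥ τ`, we have `|b_k| ≤ 1` for all `k`. -/
theorem delayed_recurrence_bounded (τ : ℕ) (hτ : 1 ≤ τ) (α : ℝ)
    (hα : 0 ≤ α) (hα2 : α ≤ 1 / (τ : ℝ))
    (b : ℕ → ℝ)
    (hinit : ∀ j, j ≤ τ → b j = 1)
    (hrec : ∀ j, τ ≤ j → b (j + 1) = b j - α * b (j - τ)) :
    ∀ k, |b k| ≤ 1 := by
  have hατ : α * τ ≤ 1 := (le_div_iff₀ (by exact_mod_cast hτ)).mp hα2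
  have hconst : ∀ j < τ, b (j + 1) = b j := fun j hj => by
    rw [hinit _ hj, hinit _ hj.le]
  intro k
  induction k using Nat.strong_induction_on with
  | _ k ih =>
    cases k with
    | zero => simp [hinit]
    | succ k =>
      have hb : ∀ j ≤ k, |b j| ≤ 1 := fun j hj => ih j (by omega)
      have hlower : -b (k + 1) ≤ 1 :=
        delayed_recurrence_succ_le_one hτ hα hατ (b := fun j => -b j)
          (fun j hj => by simp [hconst j hj])
          (fun j hj => by simp only [hrec j hj]; ring)
          (fun j hj => by simpa using hb j hj)
      exact abs_le.mpr ⟨by linarith,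
        delayed_recurrence_succ_le_one hτ hα hατ hconst hrec hb⟩
end

section
/- Let η > 0, let k ≥ 0 be an integer, and let a_0, a_1, …, a_k be real numbers with 0 < a_i < 1/η for all i. Then Σ_{i=0}^{k} a_i·(1 − η·a_i)^{2(i+1)} ≤ (1/(2eη))·(1 + ln(k+1)), where e is Euler's number. -/
/-- For `x ∈ [0, 1]`, the value of `x (1 - x) ^ n` is at most `1 / (e n)`. -/
theorem nat_mul_mul_one_sub_pow_le {x : ℝ} (hx₀ : 0 ≤ x) (hx₁ : x ≤ 1) (n : ℕ) :
    n * (x * (1 - x) ^ n) ≤ Real.exp (-1) := by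
  have hpow : (1 - x) ^ n ≤ Real.exp (-(n * x)) := by
    calc (1 - x) ^ n ≤ Real.exp (-x) ^ n :=
          pow_le_pow_left₀ (sub_nonneg.2 hx₁) (Real.one_sub_le_exp_neg x) n
      _ = Real.exp (-(n * x)) := by rw [← Real.exp_nat_mul]; ring_nf
  calc n * (x * (1 - x) ^ n) = n * x * (1 - x) ^ n := by ring
    _ ≤ n * x * Real.exp (-(n * x)) := by gcongr
    _ ≤ Real.exp (-1) := Real.mul_exp_neg_le_exp_neg_one _

/-- **Lemma 5, part 2.** For `η > 0`, integer `k ≥ 0`, and reals `a_0, …, a_k` with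
`0 < a_i < 1/η`, we have `Σ_{i=0}^{k} a_i (1 - η a_i)^{2(i+1)} ≤ (1/(2 e η))(1 + ln(k+1))`. -/
theorem sum_a_decay (η : ℝ) (hη : 0 < η) (k : ℕ)
    (a : ℕ → ℝ) (ha : ∀ i ≤ k, 0 < a i ∧ a i < 1 / η) :
    ∑ i ∈ Finset.range (k + 1), a i * (1 - η * a i) ^ (2 * (i + 1)) ≤
      (1 / (2 * Real.exp 1 * η)) * (1 + Real.log ((k : ℝ) + 1)) := by
  have hterm : ∀ i ∈ Finset.range (k + 1), a i * (1 - η * a i) ^ (2 * (i + 1)) ≤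
      (1 / (2 * Real.exp 1 * η)) * ((i : ℝ) + 1)⁻¹ := by
    intro i hi
    obtain ⟨hpos, hlt⟩ := ha i (Nat.lt_succ_iff.1 (Finset.mem_range.1 hi))
    have hle : η * a i ≤ 1 := by
      rw [lt_div_iff₀ hη] at hlt
      linarith
    have h := nat_mul_mul_one_sub_pow_le (mul_pos hη hpos).le hle (2 * (i + 1))
    rw [Real.exp_neg, ← one_div, le_div_iff₀ (Real.exp_pos 1)] at h
    push_cast at h
    rw [← one_div, div_mul_div_comm, le_div_iff₀ (by positivity)]
    linarith
  have hlog := harmonic_le_one_add_log (k + 1)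
  simp only [harmonic] at hlog
  push_cast at hlog
  calc _ ≤ ∑ i ∈ Finset.range (k + 1), (1 / (2 * Real.exp 1 * η)) * ((i : ℝ) + 1)⁻¹ :=
        Finset.sum_le_sum hterm
    _ ≤ _ := by
        rw [← Finset.mul_sum]
        gcongr
end

section
/- Let η > 0, let λ be a real number with 0 < λ < 1/η, let k ≥ 0 be an integer, and let a_0, a_1, …, a_k be real numbers with λ < a_i < 1/η for all i. Then Σ_{i=0}^{k} a_i·(1 − η·a_i)^{2(i+1)} ≤ (1 + e + ln(1/(ηλ)))/(eη), where e is Euler's number. -/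
/-- For `x ∈ [0, 1]`, the maximum of `x (1 - x) ^ m` is at most `1 / (e m)`. -/
lemma mul_one_sub_pow_le_inv {x : ℝ} (hx0 : 0 ≤ x) (hx1 : x ≤ 1) {m : ℕ} (hm : 0 < m) :
    x * (1 - x) ^ m ≤ (m : ℝ)⁻¹ / Real.exp 1 := by
  have hm' : (0 : ℝ) < m := by exact_mod_cast hm
  have h1 : (1 - x) ^ m ≤ Real.exp (-(m * x)) := by
    calc (1 - x) ^ m ≤ Real.exp (-x) ^ m :=
          pow_le_pow_left₀ (by linarith) (Real.one_sub_le_exp_neg x) m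
      _ = Real.exp (-(m * x)) := by rw [← Real.exp_nat_mul]; ring_nf
  have h2 : m * x ≤ Real.exp (m * x - 1) := by
    linarith [Real.add_one_le_exp (m * x - 1)]
  have h3 : m * x * Real.exp (-(m * x)) ≤ 1 / Real.exp 1 := by
    calc m * x * Real.exp (-(m * x)) ≤ Real.exp (m * x - 1) * Real.exp (-(m * x)) := by gcongr
      _ = 1 / Real.exp 1 := by rw [← Real.exp_add, one_div, ← Real.exp_neg]; ring_nf
  calc x * (1 - x) ^ m ≤ x * Real.exp (-(m * x)) := by gcongr
    _ = (m : ℝ)⁻¹ * (m * x * Real.exp (-(m * x))) := by field_simp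
    _ ≤ (m : ℝ)⁻¹ * (1 / Real.exp 1) := by gcongr
    _ = (m : ℝ)⁻¹ / Real.exp 1 := by ring

/-- The function `x ↦ x (1 - x) ^ m` on `[δ, 1)` is maximal at `δ` as soon as `1 ≤ m δ`. -/
lemma mul_one_sub_pow_le_of_one_le_mul {δ x : ℝ} (hδ : 0 < δ) (hδx : δ ≤ x) (hx1 : x < 1)
    {m : ℕ} (hm : 1 ≤ m * δ) : x * (1 - x) ^ m ≤ δ * (1 - δ) ^ m := by
  have hx : 0 < 1 - x := by linarith
  have hq : x - δ ≤ (x - δ) / (1 - x) := by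
    rw [le_div_iff₀ hx]; nlinarith
  have hb : 1 + m * ((x - δ) / (1 - x)) ≤ (1 + (x - δ) / (1 - x)) ^ m :=
    one_add_mul_le_pow (by linarith) m
  have he : 1 + (x - δ) / (1 - x) = (1 - δ) / (1 - x) := by field_simp; ring
  rw [he, div_pow] at hb
  have hlow : x ≤ δ * (1 + m * ((x - δ) / (1 - x))) := by
    have : (m * δ) * (x - δ) ≤ (m * δ) * ((x - δ) / (1 - x)) := by gcongr
    nlinarith
  have hfin : x ≤ δ * (1 - δ) ^ m / (1 - x) ^ m := by
    rw [mul_div_assoc]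
    exact hlow.trans (by gcongr)
  exact (le_div_iff₀ (pow_pos hx m)).1 hfin

open Finset in
/-- The normalized form (`η = 1`) of the bound. -/
lemma sum_mul_one_sub_pow_le {δ : ℝ} (hδ : 0 < δ) (hδ1 : δ < 1) (n : ℕ) (x : ℕ → ℝ)
    (hx : ∀ i < n, δ ≤ x i ∧ x i < 1) :
    ∑ i ∈ range n, x i * (1 - x i) ^ (i + 1) ≤ 1 + (1 + Real.log (1 / δ)) / Real.exp 1 := by
  set N := ⌊1 / δ⌋₊
  have hterm : ∀ i ∈ range n, x i * (1 - x i) ^ (i + 1) ≤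
      δ * (1 - δ) ^ i + if i < N then ((i + 1 : ℕ) : ℝ)⁻¹ / Real.exp 1 else 0 := by
    intro i hi
    obtain ⟨h1, h2⟩ := hx i (mem_range.1 hi)
    have hpow : 0 ≤ δ * (1 - δ) ^ i := mul_nonneg hδ.le (pow_nonneg (by linarith) i)
    split_ifs with hN
    · exact le_add_of_nonneg_of_le hpow (mul_one_sub_pow_le_inv (hδ.le.trans h1) h2.le i.succ_pos)
    · have hlt : 1 / δ < (i + 1 : ℕ) := (Nat.floor_lt (by positivity)).1 (by omega)
      have := mul_one_sub_pow_le_of_one_le_mul hδ h1 h2 ((div_lt_iff₀ hδ).1 hlt).le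
      rw [pow_succ (1 - δ)] at this
      nlinarith
  have hgeom : ∑ i ∈ range n, δ * (1 - δ) ^ i ≤ 1 := by
    have := mul_neg_geom_sum (1 - δ) n
    rw [← mul_sum]
    have hp : 0 ≤ (1 - δ) ^ n := pow_nonneg (by linarith) n
    rw [sub_sub_cancel] at this
    linarith
  have hharm : ∑ i ∈ range n, (if i < N then ((i + 1 : ℕ) : ℝ)⁻¹ / Real.exp 1 else 0) ≤
      (1 + Real.log (1 / δ)) / Real.exp 1 := by
    calc _ = ∑ i ∈ range n with i < N, ((i + 1 : ℕ) : ℝ)⁻¹ / Real.exp 1 := (sum_filter _ _).symm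
      _ ≤ ∑ i ∈ range N, ((i + 1 : ℕ) : ℝ)⁻¹ / Real.exp 1 :=
          sum_le_sum_of_subset_of_nonneg (fun i hi => by simp_all) (fun _ _ _ => by positivity)
      _ = (harmonic N : ℝ) / Real.exp 1 := by
          rw [← sum_div, harmonic]; push_cast; rfl
      _ ≤ _ := by
          gcongr
          exact harmonic_floor_le_one_add_log _ ((one_le_div hδ).2 hδ1.le)
  calc _ ≤ _ := sum_le_sum hterm
    _ ≤ _ := by rw [sum_add_distrib]; exact add_le_add hgeom hharm

/-- **Lemma 5, part 3.** For `η > 0`, `0 < lam < 1/η`, integer `k ≥ 0`, and reals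
`a_0, …, a_k` with `lam < a_i < 1/η`, we have
`Σ_{i=0}^{k} a_i (1 - η a_i)^{2(i+1)} ≤ (1 + e + ln(1/(η lam)))/(e η)`. -/
theorem sum_a_decay_strongly_convex (η lam : ℝ) (hη : 0 < η) (hlam : 0 < lam)
    (hlamη : lam < 1 / η) (k : ℕ)
    (a : ℕ → ℝ) (ha : ∀ i ≤ k, lam < a i ∧ a i < 1 / η) :
    ∑ i ∈ Finset.range (k + 1), a i * (1 - η * a i) ^ (2 * (i + 1)) ≤
      (1 + Real.exp 1 + Real.log (1 / (η * lam))) / (Real.exp 1 * η) := by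
  have hδ1 : η * lam < 1 := by rwa [lt_div_iff₀ hη, mul_comm] at hlamη
  have hx : ∀ i < k + 1, η * lam ≤ η * a i ∧ η * a i < 1 := fun i hi => by
    obtain ⟨h1, h2⟩ := ha i (by omega)
    exact ⟨by gcongr, by rwa [lt_div_iff₀ hη, mul_comm] at h2⟩
  have hmain := sum_mul_one_sub_pow_le (mul_pos hη hlam) hδ1 (k + 1) (fun i => η * a i) hx
  have hle : η * ∑ i ∈ Finset.range (k + 1), a i * (1 - η * a i) ^ (2 * (i + 1)) ≤
      ∑ i ∈ Finset.range (k + 1), η * a i * (1 - η * a i) ^ (i + 1) := by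
    rw [Finset.mul_sum]
    refine Finset.sum_le_sum fun i hi => ?_
    obtain ⟨h1, h2⟩ := hx i (Finset.mem_range.1 hi)
    have h0 : 0 < η * a i := (mul_pos hη hlam).trans_le h1
    rw [← mul_assoc]
    exact mul_le_mul_of_nonneg_left
      (pow_le_pow_of_le_one (by linarith) (by linarith) (by omega)) h0.le
  have hrhs : (1 + Real.exp 1 + Real.log (1 / (η * lam))) / (Real.exp 1 * η) =
      (1 + (1 + Real.log (1 / (η * lam))) / Real.exp 1) / η := by
    field_simp
    ring
  rw [hrhs, le_div_iff₀ hη, mul_comm]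
  exact hle.trans hmain
end

section
/- Let F : ℝ^d → ℝ be the quadratic function F(w) = (c/2)wᵀAw + d₀·ε₁ᵀw, where A ∈ ℝ^{d×d} is a tridiagonal matrix, c, d₀ are real scalars, and ε₁ is the first standard basis vector. Let τ ≥ 0 be an integer and let (w_k)_{k≥0} be a sequence in ℝ^d with w_0 = w_1 = … = w_τ = 0 and, for all k ≥ τ, w_{k+1} ∈ span{∇F(w_0), ∇F(w_1), …, ∇F(w_{k−τ})}. Then for every k ≥ 0, w_k lies in the span of the first ⌊k/(τ+1)⌋ standard basis vectors ε₁, …, ε_{⌊k/(τ+1)⌋} (interpreted as the zero subspace when ⌊k/(τ+1)⌋ = 0). -/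
open Matrix

theorem mem_span_single_lt_iff {R : Type*} [Semiring R] {d : ℕ} (n : ℕ) (v : Fin d → R) :
    v ∈ Submodule.span R
      {u : Fin d → R | ∃ j : Fin d, (j : ℕ) < n ∧ u = (Pi.single j (1 : R) : Fin d → R)} ↔
      ∀ r : Fin d, n ≤ r → v r = 0 := by
  constructor
  · intro hv r hr
    induction hv using Submodule.span_induction with
    | mem x hx =>
      obtain ⟨j, hj, rfl⟩ := hx
      exact Pi.single_eq_of_ne (by rintro rfl; omega) _
    | zero => rfl
    | add x y _ _ hx hy => simp [hx, hy]
    | smul a x _ hx => simp [hx]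
  · intro h
    rw [pi_eq_sum_univ' v]
    refine Submodule.sum_mem _ fun j _ => ?_
    by_cases hj : (j : ℕ) < n
    · refine Submodule.smul_mem _ _ (Submodule.subset_span ⟨j, hj, ?_⟩)
      ext r
      simp [Pi.single_apply]
    · simp [h j (not_lt.mp hj)]

/-- A tridiagonal matrix enlarges the support of a vector by at most one coordinate. -/
theorem tridiagonal_mulVec_eq_zero {R : Type*} [NonUnitalNonAssocSemiring R] {d : ℕ}
    {A : Matrix (Fin d) (Fin d) R}
    (htri : ∀ i j : Fin d, 1 < |(i : ℤ) - (j : ℤ)| → A i j = 0) {n : ℕ} {v : Fin d → R}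
    (hv : ∀ r : Fin d, n ≤ r → v r = 0) {r : Fin d} (hr : n + 1 ≤ r) : A.mulVec v r = 0 := by
  rw [mulVec, dotProduct]
  refine Finset.sum_eq_zero fun j _ => ?_
  by_cases hj : n ≤ j
  · rw [hv j hj, mul_zero]
  · rw [htri r j (lt_abs.mpr (Or.inl (by omega))), zero_mul]

/-- **Lemma 6 (non-zero entries under the delayed span condition).** Let
`F w = (c/2) wᵀAw + d₀ ε₁ᵀ w` with `A` tridiagonal, so `∇F(w) = c A w + d₀ ε₁`.
If `w_0 = … = w_τ = 0` and for all `k ≥ τ` the iterate `w_{k+1}` lies in the span of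
`{∇F(w_0), …, ∇F(w_{k-τ})}`, then for every `k`, `w_k` lies in the span of the first
`⌊k/(τ+1)⌋` standard basis vectors. -/
theorem delayed_span_first_coordinates {d : ℕ} (hd : 0 < d)
    (A : Matrix (Fin d) (Fin d) ℝ) (c d₀ : ℝ)
    (htri : ∀ i j : Fin d, 1 < |(i : ℤ) - (j : ℤ)| → A i j = 0)
    (τ : ℕ) (w : ℕ → (Fin d → ℝ))
    (hinit : ∀ j, j ≤ τ → w j = 0)
    (hspan : ∀ k, τ ≤ k →
      w (k + 1) ∈ Submodule.span ℝ
        {v : Fin d → ℝ | ∃ i ≤ k - τ,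
          v = c • A.mulVec (w i) + d₀ • (Pi.single (⟨0, hd⟩ : Fin d) (1 : ℝ) : Fin d → ℝ)}) :
    ∀ k, w k ∈ Submodule.span ℝ
      {v : Fin d → ℝ | ∃ j : Fin d, (j : ℕ) < k / (τ + 1) ∧
        v = (Pi.single j (1 : ℝ) : Fin d → ℝ)} := by
  simp only [mem_span_single_lt_iff]
  intro k
  induction k using Nat.strong_induction_on with
  | _ k ih =>
    rcases le_or_gt k τ with hk | hk
    · simp [hinit k hk]
    · obtain ⟨m, rfl⟩ : ∃ m, k = m + 1 := ⟨k - 1, by omega⟩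
      rw [← mem_span_single_lt_iff]
      refine Submodule.span_le.mpr ?_ (hspan m (by omega))
      rintro _ ⟨i, hi, rfl⟩
      rw [SetLike.mem_coe, mem_span_single_lt_iff]
      intro r hr
      have hdiv : i / (τ + 1) + 1 ≤ (m + 1) / (τ + 1) := by
        rw [← Nat.add_div_right i τ.succ_pos]
        exact Nat.div_le_div_right (by omega)
      have hr_pos : r ≠ ⟨0, hd⟩ := by
        rintro rfl
        exact Nat.not_succ_le_zero _ (hdiv.trans hr)
      simp [tridiagonal_mulVec_eq_zero htri (ih i (by omega)) (hdiv.trans hr), hr_pos]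
end

section
/- Let τ ≥ 0 be an integer and α ∈ (0, 1/(20(τ+1))]. Let (b_k)_{k≥0} be the real sequence with b_0 = b_1 = … = b_τ = 1 and b_{k+1} = b_k − α·b_{k−τ} for k ≥ τ (so that b_k = [z^k](1/π_α(z)) with π_α(z) = 1 − z + α·z^{τ+1}). Then for every integer k ≥ (τ+1)·ln(2(τ+1)), |b_k| ≤ 3·(1 − α)^{k+1}. -/
/-- A finite sequence with consecutive ratios in `[r, 1]` loses at most a factor `r ^ i` over
`i` steps. -/
theorem le_and_pow_mul_le_of_step {r : ℝ} (hr : 0 ≤ r) {b : ℕ → ℝ} {n : ℕ}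
    (h : ∀ m < n, b (m + 1) ≤ b m ∧ r * b m ≤ b (m + 1)) :
    ∀ i ≤ n, b n ≤ b (n - i) ∧ r ^ i * b (n - i) ≤ b n := by
  intro i
  induction i with
  | zero => intro _; simp
  | succ i ih =>
    intro hi
    obtain ⟨h1, h2⟩ := ih (by omega)
    obtain ⟨h3, h4⟩ := h (n - (i + 1)) (by omega)
    rw [show n - (i + 1) + 1 = n - i by omega] at h3 h4
    refine ⟨h1.trans h3, le_trans ?_ h2⟩
    rw [pow_succ, mul_assoc]
    exact mul_le_mul_of_nonneg_left h4 (pow_nonneg hr i)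

/-- The delayed recurrence with small step is positive, and its consecutive ratios lie in
`[1 - 2 * α, 1]`. -/
theorem delayed_recurrence_pos_and_step {τ : ℕ} {α : ℝ} (hα : 0 < α)
    (hατ : 20 * (α * ((τ : ℝ) + 1)) ≤ 1) {b : ℕ → ℝ}
    (hinit : ∀ j, j ≤ τ → b j = 1)
    (hrec : ∀ j, τ ≤ j → b (j + 1) = b j - α * b (j - τ)) (n : ℕ) :
    0 < b n ∧ ∀ m < n, b (m + 1) ≤ b m ∧ (1 - 2 * α) * b m ≤ b (m + 1) := by
  have hτ : 0 ≤ α * (τ : ℝ) := by positivity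
  induction n with
  | zero => simp [hinit 0 (Nat.zero_le τ)]
  | succ n ih =>
    obtain ⟨hpos, hstep⟩ := ih
    have key : b (n + 1) ≤ b n ∧ (1 - 2 * α) * b n ≤ b (n + 1) := by
      rcases lt_or_ge n τ with hn | hn
      · rw [hinit n hn.le, hinit (n + 1) hn]
        constructor <;> linarith
      · obtain ⟨h1, h2⟩ := le_and_pow_mul_le_of_step (by linarith) hstep τ hn
        have hbern := one_add_mul_le_pow (a := -(2 * α)) (by linarith) τ
        rw [← sub_eq_add_neg] at hbern
        have h3 : 1 / 2 * b (n - τ) ≤ b n :=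
          le_trans (mul_le_mul_of_nonneg_right (by linarith) (by linarith)) h2
        rw [hrec n hn]
        constructor <;> nlinarith
    refine ⟨lt_of_lt_of_le (mul_pos (by linarith) hpos) key.2, fun m hm => ?_⟩
    rcases Nat.lt_succ_iff_lt_or_eq.mp hm with h | rfl
    · exact hstep m h
    · exact key

/-- Beyond the initial segment the delayed recurrence decays at least like `(1 - α) ^ i`. -/
theorem delayed_recurrence_le_pow {τ : ℕ} {α : ℝ} (hα : 0 < α)
    (hατ : 20 * (α * ((τ : ℝ) + 1)) ≤ 1) {b : ℕ → ℝ}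
    (hinit : ∀ j, j ≤ τ → b j = 1)
    (hrec : ∀ j, τ ≤ j → b (j + 1) = b j - α * b (j - τ)) (i : ℕ) :
    b (τ + i) ≤ (1 - α) ^ i := by
  have hτ : 0 ≤ α * (τ : ℝ) := by positivity
  induction i with
  | zero => simp [hinit τ le_rfl]
  | succ i ih =>
    have hstep := (delayed_recurrence_pos_and_step hα hατ hinit hrec (τ + i)).2
    have h1 := (le_and_pow_mul_le_of_step (by linarith) hstep τ (by omega)).1
    rw [← add_assoc, hrec _ (by omega), pow_succ]
    nlinarith

/-- **Coefficient decay of `1/π_α`.** For `τ ≥ 0`, `α ∈ (0, 1/(20(τ+1))]`, and the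
sequence with `b_0 = … = b_τ = 1` and `b_{k+1} = b_k - α b_{k-τ}` for `k ≥ τ`
(i.e. `b_k = [z^k](1/π_α(z))`), every integer `k ≥ (τ+1) ln(2(τ+1))` satisfies
`|b_k| ≤ 3 (1 - α)^{k+1}`. -/
theorem delayed_recurrence_decay (τ : ℕ) (α : ℝ) (hα : 0 < α)
    (hα2 : α ≤ 1 / (20 * ((τ : ℝ) + 1)))
    (b : ℕ → ℝ)
    (hinit : ∀ j, j ≤ τ → b j = 1)
    (hrec : ∀ j, τ ≤ j → b (j + 1) = b j - α * b (j - τ))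
    (k : ℕ) (hk : ((τ : ℝ) + 1) * Real.log (2 * ((τ : ℝ) + 1)) ≤ (k : ℝ)) :
    |b k| ≤ 3 * (1 - α) ^ (k + 1) := by
  have hατ : 20 * (α * ((τ : ℝ) + 1)) ≤ 1 := by
    rw [le_div_iff₀ (by positivity)] at hα2
    linarith
  have hτ : 0 ≤ α * (τ : ℝ) := by positivity
  have hα1 : 0 ≤ 1 - α := by linarith
  have hbern : 1 ≤ 3 * (1 - α) ^ (τ + 1) := by
    have h := one_add_mul_le_pow (a := -α) (by linarith) (τ + 1)
    rw [← sub_eq_add_neg] at h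
    push_cast at h
    linarith
  rw [abs_of_pos (delayed_recurrence_pos_and_step hα hατ hinit hrec k).1]
  rcases le_total k τ with h | h
  · rw [hinit k h]
    have := pow_le_pow_of_le_one hα1 (by linarith) (Nat.add_le_add_right h 1)
    linarith
  · obtain ⟨i, rfl⟩ := Nat.exists_eq_add_of_le h
    calc b (τ + i) ≤ 1 * (1 - α) ^ i := by
          simpa using delayed_recurrence_le_pow hα hατ hinit hrec i
      _ ≤ 3 * (1 - α) ^ (τ + 1) * (1 - α) ^ i :=
          mul_le_mul_of_nonneg_right hbern (pow_nonneg hα1 i)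
      _ = 3 * (1 - α) ^ (τ + i + 1) := by ring
end

section
/- Let A ∈ ℝ^{d×d} be symmetric with all eigenvalues in [λ, μ] where 0 ≤ λ ≤ μ and μ > 0. Let τ ≥ 0 be an integer and η ∈ (0, 1/(20μ(τ+1))]. Let (e_k)_{k≥0} be a sequence in ℝ^d with e_0 = e_1 = … = e_τ and e_{k+1} = e_k − ηA·e_{k−τ} for all k ≥ τ. Then for every integer k ≥ (τ+1)·ln(2(τ+1)), ‖e_k‖ ≤ 3·(1 − ηλ)^{k+1}·‖e_0‖. -/
open Matrix

/-- Solutions of the scalar recurrence with nonnegative initial value are nonnegative, decreasing,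
and shrink by a factor of at least `1 - 2 * a` at each step. -/
lemma delayed_scalar_invariants {τ : ℕ} {a : ℝ} (ha : 0 ≤ a) (haτ : a * (τ + 1) ≤ 1 / 20)
    {c : ℕ → ℝ} (hc0 : 0 ≤ c 0) (hinit : ∀ j, j ≤ τ → c j = c 0)
    (hrec : ∀ j, τ ≤ j → c (j + 1) = c j - a * c (j - τ)) (k : ℕ) :
    0 ≤ c k ∧ (1 - 2 * a) * c k ≤ c (k + 1) ∧ c (k + 1) ≤ c k := by
  have haτ0 : 0 ≤ a * τ := by positivity
  have ha1 : 0 ≤ 1 - 2 * a := by linarith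
  induction k using Nat.strong_induction_on with
  | _ k ih =>
    have hck : 0 ≤ c k := by
      rcases k with _ | k
      · exact hc0
      · obtain ⟨h0, h1, -⟩ := ih k (Nat.lt_succ_self k)
        exact (mul_nonneg ha1 h0).trans h1
    refine ⟨hck, ?_⟩
    rcases lt_or_ge k τ with hk | hk
    · rw [hinit (k + 1) hk, hinit k hk.le]
      exact ⟨by nlinarith, le_rfl⟩
    · have hpow : ∀ m, m ≤ k → (1 - 2 * a) ^ m * c (k - m) ≤ c k := by
        intro m
        induction m with
        | zero => simp
        | succ m ihm =>
          intro hm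
          have h1 := (ih (k - (m + 1)) (by omega)).2.1
          rw [show k - (m + 1) + 1 = k - m by omega] at h1
          calc (1 - 2 * a) ^ (m + 1) * c (k - (m + 1))
              = (1 - 2 * a) ^ m * ((1 - 2 * a) * c (k - (m + 1))) := by ring
            _ ≤ (1 - 2 * a) ^ m * c (k - m) := by gcongr
            _ ≤ c k := ihm (by omega)
      have hd : 0 ≤ c (k - τ) := by
        rcases Nat.eq_zero_or_pos τ with h | h
        · simpa [h] using hck
        · exact (ih (k - τ) (by omega)).1
      have hb : 9 / 10 ≤ (1 - 2 * a) ^ τ := by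
        have := one_add_mul_le_pow (a := -(2 * a)) (by linarith) τ
        rw [← sub_eq_add_neg] at this
        linarith
      have h9 : 9 / 10 * c (k - τ) ≤ c k :=
        (mul_le_mul_of_nonneg_right hb hd).trans (hpow τ hk)
      rw [hrec k hk]
      have hp := mul_nonneg ha hd
      have h2 : a * c (k - τ) ≤ a * (2 * c k) :=
        mul_le_mul_of_nonneg_left (by linarith) ha
      exact ⟨by linarith, by linarith⟩

lemma delayed_scalar_le_of_nonneg {τ : ℕ} {a : ℝ} (ha : 0 ≤ a) (haτ : a * (τ + 1) ≤ 1 / 20)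
    {c : ℕ → ℝ} (hc0 : 0 ≤ c 0) (hinit : ∀ j, j ≤ τ → c j = c 0)
    (hrec : ∀ j, τ ≤ j → c (j + 1) = c j - a * c (j - τ)) (k : ℕ) :
    |c k| ≤ 3 * (1 - a) ^ (k + 1) * |c 0| := by
  have hinv := delayed_scalar_invariants ha haτ hc0 hinit hrec
  have haτ0 : 0 ≤ a * τ := by positivity
  have ha1 : 0 ≤ 1 - a := by linarith
  have hanti : Antitone c := antitone_nat_of_succ_le fun n => (hinv n).2.2
  have hdecay : ∀ m, c (τ + m) ≤ (1 - a) ^ m * c 0 := by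
    intro m
    induction m with
    | zero => simp [hinit τ le_rfl]
    | succ m ihm =>
      rw [← add_assoc, hrec _ (by omega)]
      have h1 : a * c (τ + m) ≤ a * c (τ + m - τ) :=
        mul_le_mul_of_nonneg_left (hanti (by omega)) ha
      calc c (τ + m) - a * c (τ + m - τ) ≤ (1 - a) * c (τ + m) := by linarith
        _ ≤ (1 - a) * ((1 - a) ^ m * c 0) := by gcongr
        _ = (1 - a) ^ (m + 1) * c 0 := by ring
  have hone : 1 ≤ 3 * (1 - a) ^ (τ + 1) := by
    have := one_add_mul_le_pow (a := -a) (by linarith) (τ + 1)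
    rw [← sub_eq_add_neg] at this
    push_cast at this
    linarith
  rw [abs_of_nonneg (hinv k).1, abs_of_nonneg hc0]
  rcases lt_or_ge k τ with hk | hk
  · rw [hinit k hk.le]
    have : (1 - a) ^ (τ + 1) ≤ (1 - a) ^ (k + 1) :=
      pow_le_pow_of_le_one ha1 (by linarith) (by omega)
    nlinarith
  · obtain ⟨m, rfl⟩ := Nat.exists_eq_add_of_le hk
    have hm : 0 ≤ (1 - a) ^ m * c 0 := by positivity
    calc c (τ + m) ≤ 1 * ((1 - a) ^ m * c 0) := by simpa using hdecay m
      _ ≤ 3 * (1 - a) ^ (τ + 1) * ((1 - a) ^ m * c 0) := by gcongr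
      _ = 3 * (1 - a) ^ (τ + m + 1) * c 0 := by ring

lemma delayed_scalar_abs_le {τ : ℕ} {a : ℝ} (ha : 0 ≤ a) (haτ : a * (τ + 1) ≤ 1 / 20)
    {c : ℕ → ℝ} (hinit : ∀ j, j ≤ τ → c j = c 0)
    (hrec : ∀ j, τ ≤ j → c (j + 1) = c j - a * c (j - τ)) (k : ℕ) :
    |c k| ≤ 3 * (1 - a) ^ (k + 1) * |c 0| := by
  rcases le_total 0 (c 0) with h | h
  · exact delayed_scalar_le_of_nonneg ha haτ h hinit hrec k
  · simpa using delayed_scalar_le_of_nonneg (c := fun j => -c j) ha haτ (by simpa using h)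
      (fun j hj => by simp [hinit j hj]) (fun j hj => by simp only [hrec j hj]; ring) k

lemma eNorm_eq_norm_toLp {d : ℕ} (v : Fin d → ℝ) : eNorm v = ‖WithLp.toLp 2 v‖ := by
  simp [eNorm, EuclideanSpace.norm_eq]

lemma inner_eigenvectorBasis_mulVec {d : ℕ} {A : Matrix (Fin d) (Fin d) ℝ}
    (hA : A.IsHermitian) (i : Fin d) (v : Fin d → ℝ) :
    inner ℝ (hA.eigenvectorBasis i) (WithLp.toLp 2 (A *ᵥ v)) =
      hA.eigenvalues i * inner ℝ (hA.eigenvectorBasis i) (WithLp.toLp 2 v) := by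
  have hT : Aᵀ = A := by simpa [IsHermitian, conjTranspose_eq_transpose_of_trivial] using hA
  simp only [EuclideanSpace.inner_eq_star_dotProduct, star_trivial]
  rw [dotProduct_comm, dotProduct_mulVec, ← mulVec_transpose, hT, hA.mulVec_eigenvectorBasis,
    smul_dotProduct, smul_eq_mul, dotProduct_comm]

/-- **Decay of the delayed vector recurrence.** Let `A` be symmetric with all
eigenvalues in `[lam, mu]`, `0 ≤ lam ≤ mu`, `mu > 0`, `η ∈ (0, 1/(20 mu (τ+1))]`.
If `e_0 = … = e_τ` and `e_{k+1} = e_k - η A e_{k-τ}` for `k ≥ τ`, then for every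
`k ≥ (τ+1) ln(2(τ+1))`, `‖e_k‖ ≤ 3 (1 - η lam)^{k+1} ‖e_0‖`. -/
theorem delayed_vector_recurrence_decay {d : ℕ} (A : Matrix (Fin d) (Fin d) ℝ)
    (hA : A.IsHermitian) (lam mu : ℝ) (hlam : 0 ≤ lam) (hlm : lam ≤ mu) (hmu : 0 < mu)
    (heig : ∀ i, lam ≤ hA.eigenvalues i ∧ hA.eigenvalues i ≤ mu)
    (τ : ℕ) (η : ℝ) (hη : 0 < η) (hη2 : η ≤ 1 / (20 * mu * (τ + 1)))
    (e : ℕ → (Fin d → ℝ))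
    (hinit : ∀ j, j ≤ τ → e j = e 0)
    (hrec : ∀ j, τ ≤ j → e (j + 1) = e j - η • A.mulVec (e (j - τ)))
    (k : ℕ) (hk : ((τ : ℝ) + 1) * Real.log (2 * ((τ : ℝ) + 1)) ≤ (k : ℝ)) :
    eNorm (e k) ≤ 3 * (1 - η * lam) ^ (k + 1) * eNorm (e 0) := by
  have hη3 : η * mu * (τ + 1) ≤ 1 / 20 := by
    have := (le_div_iff₀ (by positivity)).1 hη2
    linarith
  have hmuτ : 0 ≤ η * mu * τ := by positivity
  have hlamle : η * lam ≤ η * mu := mul_le_mul_of_nonneg_left hlm hη.le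
  have hlam1 : 0 ≤ 1 - η * lam := by linarith
  have hcoord : ∀ i, |inner ℝ (hA.eigenvectorBasis i) (WithLp.toLp 2 (e k))| ≤
      3 * (1 - η * lam) ^ (k + 1) *
        |inner ℝ (hA.eigenvectorBasis i) (WithLp.toLp 2 (e 0))| := by
    intro i
    obtain ⟨hl, hu⟩ := heig i
    have hle : η * hA.eigenvalues i ≤ η * mu := mul_le_mul_of_nonneg_left hu hη.le
    refine (delayed_scalar_abs_le (τ := τ) (a := η * hA.eigenvalues i)
      (c := fun j => inner ℝ (hA.eigenvectorBasis i) (WithLp.toLp 2 (e j)))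
      (mul_nonneg hη.le (hlam.trans hl)) ?_ (fun j hj => by simp only [hinit j hj])
      (fun j hj => ?_) k).trans ?_
    · exact (mul_le_mul_of_nonneg_right hle (by positivity)).trans hη3
    · simp only [hrec j hj, WithLp.toLp_sub, WithLp.toLp_smul, inner_sub_right,
        inner_smul_right, inner_eigenvectorBasis_mulVec]
      ring
    · have : 0 ≤ 1 - η * hA.eigenvalues i := by linarith
      gcongr
  rw [eNorm_eq_norm_toLp, eNorm_eq_norm_toLp]
  refine (sq_le_sq₀ (norm_nonneg _) (by positivity)).1 ?_
  rw [mul_pow, ← hA.eigenvectorBasis.sum_sq_norm_inner_right,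
    ← hA.eigenvectorBasis.sum_sq_norm_inner_right, Finset.mul_sum]
  refine Finset.sum_le_sum fun i _ => ?_
  rw [← mul_pow]
  exact pow_le_pow_left₀ (norm_nonneg _) (hcoord i) 2
end

section
/- Let τ ≥ 0 be an integer and α ∈ (0, 1/(20(τ+1))]. Then the real polynomial p_α(z) = (z − 1)·z^τ + α has a real root in the interval (1 − 1/(2(τ+1)), 1 − α]; that is, there exists x ∈ ℝ with 1 − 1/(2(τ+1)) < x ≤ 1 − α and (x − 1)x^τ + α = 0. -/
/-- **Real root of `p_α`.** For `τ ≥ 0` and `α ∈ (0, 1/(20(τ+1))]`, the polynomial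
`p_α(z) = (z-1) z^τ + α` has a real root in `(1 - 1/(2(τ+1)), 1 - α]`. -/
theorem p_alpha_real_root (τ : ℕ) (α : ℝ) (hα : 0 < α)
    (hα2 : α ≤ 1 / (20 * ((τ : ℝ) + 1))) :
    ∃ x : ℝ, 1 - 1 / (2 * ((τ : ℝ) + 1)) < x ∧ x ≤ 1 - α ∧
      (x - 1) * x ^ τ + α = 0 := by
  have hτ : (0 : ℝ) ≤ τ := τ.cast_nonneg
  obtain ⟨s, hs⟩ : ∃ s : ℝ, s = 1 / ((τ : ℝ) + 1) := ⟨_, rfl⟩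
  have hs0 : 0 < s := by rw [hs]; positivity
  have hτs : τ * s = 1 - s := by rw [hs]; field_simp; ring
  have hs1 : s ≤ 1 := by nlinarith
  have h20 : 1 / (20 * ((τ : ℝ) + 1)) = s / 20 := by rw [hs]; field_simp
  have h2 : 1 / (2 * ((τ : ℝ) + 1)) = s / 2 := by rw [hs]; field_simp
  rw [h20] at hα2
  rw [h2]
  have bernoulli : 1 + τ * (-(s / 2)) ≤ (1 + -(s / 2)) ^ τ :=
    one_add_mul_le_pow (by linarith) τ
  have hpow : 1 / 2 ≤ (1 - s / 2) ^ τ := by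
    rw [← sub_eq_add_neg] at bernoulli
    linarith
  have hleft : (1 - s / 2 - 1) * (1 - s / 2) ^ τ + α < 0 := by nlinarith
  have hright : 0 ≤ (1 - α - 1) * (1 - α) ^ τ + α := by
    have : (1 - α) ^ τ ≤ 1 := pow_le_one₀ (by linarith) (by linarith)
    nlinarith
  have hcont : ContinuousOn (fun x : ℝ => (x - 1) * x ^ τ + α) (Set.Icc (1 - s / 2) (1 - α)) := by
    fun_prop
  obtain ⟨x, hx, hroot⟩ := intermediate_value_Ioc (by linarith) hcont ⟨hleft, hright⟩
  exact ⟨x, hx.1, hx.2, hroot⟩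
end
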